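/- arXiv:2007.13170 — 10 statements merged into one kernel-verified Lean document; each statement's English description precedes it below -/
import Mathlib

section
/- Let H, H' be separable complex Hilbert spaces and suppose the operators B_0,…,B_m satisfy conditions (B1), (B2), (B4). Then H_B ⊆ D_B := ⋂_{j=0}^m D(B_j); for every x ∈ H_B and every j = 0,…,m the series ∑_{n∈M} x_n · B_j e_n converges in H' to B_j x; and for every h ∈ (0,∞)^{m+1} one has ‖x‖²_{B,h} = ∑_{j=0}^m h_j ‖B_j x‖²_{H'}. -/
open scoped InnerProductSpace ENNReal

/-- A pairwise orthogonal family in a Hilbert space is summable as soon as its squared norms are. -/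
theorem summable_of_pairwise_inner_eq_zero {ι E : Type*} [NormedAddCommGroup E]
    [InnerProductSpace ℂ E] [CompleteSpace E] {v : ι → E}
    (hv : Pairwise fun i k => ⟪v i, v k⟫_ℂ = 0) (hs : Summable fun i => ‖v i‖ ^ 2) :
    Summable v := by
  have hV : OrthogonalFamily ℂ (fun i => ℂ ∙ v i) fun i => (ℂ ∙ v i).subtypeₗᵢ :=
    OrthogonalFamily.of_pairwise fun i k hik =>
      Submodule.isOrtho_span.2 (by simpa using hv hik)
  exact (hV.summable_iff_norm_sq_summable
    fun i => ⟨v i, Submodule.mem_span_singleton_self _⟩).2 hs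

/-- Pythagoras' theorem for the sum of a pairwise orthogonal family. -/
theorem HasSum.norm_sq_of_pairwise_inner_eq_zero {ι E : Type*} [NormedAddCommGroup E]
    [InnerProductSpace ℂ E] {v : ι → E} {s : E} (hs : HasSum v s)
    (hv : Pairwise fun i k => ⟪v i, v k⟫_ℂ = 0) :
    HasSum (fun i => ‖v i‖ ^ 2) (‖s‖ ^ 2) := by
  have hinner (i : ι) : ⟪v i, s⟫_ℂ = ⟪v i, v i⟫_ℂ :=
    (hs.mapL (innerSL ℂ (v i))).unique (hasSum_single i fun k hk => hv hk.symm)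
  have hsum := Complex.hasSum_re (hs.mapL (innerSL ℂ s))
  simp only [innerSL_apply_apply] at hsum
  convert hsum using 1
  · ext i
    rw [← inner_conj_symm, hinner, inner_self_eq_norm_sq_to_K]
    norm_cast
  · rw [inner_self_eq_norm_sq_to_K]
    norm_cast

/-- A closed operator may be applied term by term to a convergent series in its domain whose
series of images converges. -/
theorem LinearPMap.IsClosed.hasSum_mem_graph {ι E F : Type*} [NormedAddCommGroup E]
    [InnerProductSpace ℂ E] [NormedAddCommGroup F] [InnerProductSpace ℂ F]
    {T : E →ₗ.[ℂ] F} (hT : T.IsClosed) {u : ι → E} {w : ι → F} {x : E} {y : F}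
    (hu : HasSum u x) (hw : HasSum w y) (huw : ∀ i, (u i, w i) ∈ T.graph) :
    (x, y) ∈ T.graph :=
  IsClosed.mem_of_tendsto hT (hu.prodMk hw)
    (Filter.Eventually.of_forall fun _ => T.graph.sum_mem fun i _ => huw i)

/-- Let `H`, `H'` be separable complex Hilbert spaces, with an orthonormal
(Hilbert) basis `e` of `H` indexed by a countable type `ι`, and let `B 0, …, B m` be (possibly
unbounded) closed linear operators from `H` to `H'` (condition (B4)) whose domains contain every
basis vector (condition (B1)) and which map distinct basis vectors to orthogonal vectors
(condition (B2)).  Then every `x ∈ H_B` (i.e. every `x` with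
`∑_n ‖x_n‖² ‖B_j e_n‖² < ∞` for each `j`) belongs to `⋂_j D(B_j)`; moreover the series
`∑_n x_n • B_j e_n` converges to `B_j x`, and for every positive weight vector `h` one has
`‖x‖²_{B,h} = ∑_j h_j ‖B_j x‖²`. -/
theorem statement0
    {H H' : Type*} [NormedAddCommGroup H] [InnerProductSpace ℂ H] [CompleteSpace H]
    [NormedAddCommGroup H'] [InnerProductSpace ℂ H'] [CompleteSpace H']
    {ι : Type*} [Countable ι] (e : HilbertBasis ι ℂ H)
    (m : ℕ) (B : Fin (m + 1) → H →ₗ.[ℂ] H')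
    (hB1 : ∀ j n, e n ∈ (B j).domain)
    (hB2 : ∀ (j) (n n' : ι), n ≠ n' →
      ⟪(B j) ⟨e n, hB1 j n⟩, (B j) ⟨e n', hB1 j n'⟩⟫_ℂ = 0)
    (hB4 : ∀ j, (B j).IsClosed)
    (x : H)
    (hx : ∀ j, Summable fun n => ‖e.repr x n‖ ^ 2 * ‖(B j) ⟨e n, hB1 j n⟩‖ ^ 2) :
    ∃ hxd : ∀ j, x ∈ (B j).domain,
      (∀ j, HasSum (fun n => e.repr x n • (B j) ⟨e n, hB1 j n⟩) ((B j) ⟨x, hxd j⟩)) ∧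
      ∀ h : Fin (m + 1) → ℝ, (∀ j, 0 < h j) →
        ∑' n, ‖e.repr x n‖ ^ 2 * (∑ j, h j * ‖(B j) ⟨e n, hB1 j n⟩‖ ^ 2)
          = ∑ j, h j * ‖(B j) ⟨x, hxd j⟩‖ ^ 2 := by
  set c := fun (j : Fin (m + 1)) (n : ι) => e.repr x n • (B j) ⟨e n, hB1 j n⟩ with hc
  have horth (j) : Pairwise fun n n' => ⟪c j n, c j n'⟫_ℂ = 0 := fun n n' hn => by
    simp [hc, hB2 j n n' hn]
  have hnorm (j n) : ‖c j n‖ ^ 2 = ‖e.repr x n‖ ^ 2 * ‖(B j) ⟨e n, hB1 j n⟩‖ ^ 2 := by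
    simp only [hc, norm_smul, mul_pow]
  have hsum (j) : Summable (c j) :=
    summable_of_pairwise_inner_eq_zero (horth j) (by simpa only [hnorm] using hx j)
  have hgraph (j) : (x, ∑' n, c j n) ∈ (B j).graph :=
    (hB4 j).hasSum_mem_graph (e.hasSum_repr x) (hsum j).hasSum fun n =>
      (B j).graph.smul_mem (e.repr x n) ((B j).mem_graph ⟨e n, hB1 j n⟩)
  have hxd (j) : x ∈ (B j).domain := LinearPMap.mem_domain_of_mem_graph (hgraph j)
  have hB (j) : HasSum (c j) ((B j) ⟨x, hxd j⟩) := by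
    have := ((B j).image_iff (hxd j)).2 (hgraph j)
    exact this ▸ (hsum j).hasSum
  refine ⟨hxd, hB, fun h _ => ?_⟩
  have hpyth := hasSum_sum fun j (_ : j ∈ Finset.univ) =>
    ((hB j).norm_sq_of_pairwise_inner_eq_zero (horth j)).mul_left (h j)
  rw [← hpyth.tsum_eq]
  refine tsum_congr fun n => ?_
  rw [Finset.mul_sum]
  exact Finset.sum_congr rfl fun j _ => by rw [hnorm]; ring
end

section
/- Suppose B_0,…,B_m satisfy (B1)–(B4), the operator A and the functional f ∈ X* satisfy (A1), (Af1), (Af2), and ∑~_{n∈M} |⟨f, A e_n⟩|² / b_{n,1} < ∞, where 1 = (1,…,1). Then for every h ∈ (0,∞)^{m+1} and every x ∈ D(A) ∩ H_B, one has |⟨f, Ax⟩| ≤ ( ∑~_{n∈M} |⟨f, A e_n⟩|² / b_{n,h} )^{1/2} · ‖x‖_{B,h}. -/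
open scoped InnerProductSpace ENNReal NNReal

/-- A closable linear functional is bounded on its domain. -/
theorem LinearPMap.IsClosable.exists_bound {H : Type*} [NormedAddCommGroup H] [NormedSpace ℂ H]
    {g : H →ₗ.[ℂ] ℂ} (hg : g.IsClosable) : ∃ C : ℝ, ∀ y : g.domain, ‖g y‖ ≤ C * ‖(y : H)‖ := by
  by_contra! hC
  choose y hy using fun k : ℕ => hC (k + 1)
  have hpos : ∀ k, 0 < ‖g (y k)‖ := fun k => lt_of_le_of_lt (by positivity) (hy k)
  have hne : ∀ k, g (y k) ≠ 0 := fun k => norm_pos_iff.1 (hpos k)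
  let z : ℕ → g.domain := fun k => (g (y k))⁻¹ • y k
  have hz1 : ∀ k, g (z k) = 1 := fun k => by
    simp [z, LinearPMap.map_smul, hne k]
  have hz0 : Filter.Tendsto (fun k => (z k : H)) Filter.atTop (nhds 0) := by
    refine squeeze_zero_norm (fun k => ?_) tendsto_one_div_add_atTop_nhds_zero_nat
    have hk : (0 : ℝ) < k + 1 := by positivity
    have : ‖(z k : H)‖ = ‖(y k : H)‖ / ‖g (y k)‖ := by
      simp [z, norm_smul, div_eq_inv_mul]
    rw [this, div_le_div_iff₀ (hpos k) hk]
    linarith [hy k]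
  obtain ⟨g', hg'⟩ := hg
  have hmem : ((0 : H), (1 : ℂ)) ∈ g.graph.topologicalClosure := by
    refine mem_closure_of_tendsto (hz0.prodMk_nhds tendsto_const_nhds)
      (Filter.Eventually.of_forall fun k => ?_)
    have := g.mem_graph (z k)
    rwa [hz1 k] at this
  rw [hg'] at hmem
  exact one_ne_zero (g'.graph_fst_eq_zero_snd hmem rfl)

/-- A bounded functional is recovered along basis expansions, so a uniform bound on the
partial sums of its expansion bounds its value. -/
theorem LinearPMap.norm_le_of_forall_sum_le {H : Type*} [NormedAddCommGroup H]
    [InnerProductSpace ℂ H] {ι : Type*} (e : HilbertBasis ι ℂ H)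
    {g : H →ₗ.[ℂ] ℂ} (hg : g.IsClosable) (he : ∀ n, e n ∈ g.domain) (x : g.domain) {K : ℝ}
    (hK : ∀ F : Finset ι, ∑ n ∈ F, ‖e.repr x n‖ * ‖g ⟨e n, he n⟩‖ ≤ K) : ‖g x‖ ≤ K := by
  obtain ⟨C, hC⟩ := hg.exists_bound
  let s : Finset ι → g.domain := fun F => ∑ n ∈ F, e.repr x n • (⟨e n, he n⟩ : g.domain)
  have hs : Filter.Tendsto (fun F => (s F : H)) Filter.atTop (nhds (x : H)) := by
    have := e.hasSum_repr (x : H)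
    simpa [s, HasSum] using this
  have hgs : ∀ F, ‖g (s F)‖ ≤ K := fun F => by
    have : g (s F) = ∑ n ∈ F, e.repr x n * g ⟨e n, he n⟩ := by
      change g.toFun (s F) = ∑ n ∈ F, e.repr x n * g.toFun ⟨e n, he n⟩
      rw [map_sum]
      exact Finset.sum_congr rfl fun n _ => g.toFun.map_smul _ _
    rw [this]
    refine (norm_sum_le _ _).trans ?_
    simpa using hK F
  have hlim : Filter.Tendsto (fun F => K + C * ‖(x : H) - s F‖) Filter.atTop (nhds K) := by
    have := ((tendsto_const_nhds (x := (x : H))).sub hs).norm.const_mul C |>.const_add K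
    simpa using this
  refine ge_of_tendsto' hlim fun F => ?_
  calc ‖g x‖ = ‖g (s F) + g (x - s F)‖ := by rw [LinearPMap.map_sub]; simp
    _ ≤ ‖g (s F)‖ + ‖g (x - s F)‖ := norm_add_le _ _
    _ ≤ K + C * ‖(x : H) - s F‖ := add_le_add (hgs F) (hC (x - s F))

/-- Weighted Cauchy–Schwarz inequality for finite partial sums, with a possibly vanishing weight
`b` and the `ℝ≥0∞` division convention. -/
theorem sum_mul_le_sqrt_tsum_div_mul_sqrt_tsum {ι : Type*} {a : ι → ℂ} {b c : ι → ℝ}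
    (hb : ∀ n, 0 ≤ b n)
    (ha : (∑' n, (‖a n‖₊ : ℝ≥0∞) ^ 2 / ENNReal.ofReal (b n)) ≠ ⊤)
    (hcb : Summable fun n => c n ^ 2 * b n) (F : Finset ι) :
    ∑ n ∈ F, c n * ‖a n‖ ≤
      Real.sqrt (∑' n, (‖a n‖₊ : ℝ≥0∞) ^ 2 / ENNReal.ofReal (b n)).toReal *
        Real.sqrt (∑' n, c n ^ 2 * b n) := by
  have hfin : ∀ n, (‖a n‖₊ : ℝ≥0∞) ^ 2 / ENNReal.ofReal (b n) ≠ ⊤ :=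
    ENNReal.ne_top_of_tsum_ne_top ha
  have hsq : ∀ n ∈ F, (c n * ‖a n‖) ^ 2 =
      ((‖a n‖₊ : ℝ≥0∞) ^ 2 / ENNReal.ofReal (b n)).toReal * (c n ^ 2 * b n) := fun n _ => by
    have hq : ((‖a n‖₊ : ℝ≥0∞) ^ 2 / ENNReal.ofReal (b n)).toReal = ‖a n‖ ^ 2 / b n := by
      simp [ENNReal.toReal_div, ENNReal.toReal_ofReal (hb n)]
    rw [hq]
    rcases (hb n).eq_or_lt with h0 | h0
    · have : a n = 0 := by
        by_contra hne
        refine hfin n ?_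
        rw [← h0, ENNReal.ofReal_zero]
        exact ENNReal.div_zero (by simpa using hne)
      simp [this]
    · field_simp
  have hnn : ∀ n, 0 ≤ c n ^ 2 * b n := fun n => mul_nonneg (sq_nonneg _) (hb n)
  have key := Finset.sum_sq_le_sum_mul_sum_of_sq_le_mul F
    (fun n _ => ENNReal.toReal_nonneg) (fun n _ => hnn n) fun n hn => (hsq n hn).le
  rw [← Real.sqrt_mul ENNReal.toReal_nonneg]
  refine Real.le_sqrt_of_sq_le (key.trans ?_)
  refine mul_le_mul ?_ (hcb.sum_le_tsum F fun n _ => hnn n)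
    (Finset.sum_nonneg fun n _ => hnn n) ENNReal.toReal_nonneg
  rw [← ENNReal.toReal_sum fun n _ => hfin n]
  exact ENNReal.toReal_mono ha (ENNReal.sum_le_tsum F)

/-- Finiteness of a regularized sum is preserved when the weights are replaced by larger ones, up
to a positive constant factor. -/
theorem tsum_div_ofReal_ne_top_of_mul_le {ι : Type*} {a : ι → ℝ≥0∞} {b b' : ι → ℝ} {k : ℝ}
    (hk : 0 < k) (hle : ∀ n, k * b n ≤ b' n) (ha : (∑' n, a n / ENNReal.ofReal (b n)) ≠ ⊤) :
    (∑' n, a n / ENNReal.ofReal (b' n)) ≠ ⊤ := by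
  have hk0 : ENNReal.ofReal k ≠ 0 := by simpa using hk
  refine ne_top_of_le_ne_top (ENNReal.mul_ne_top (ENNReal.inv_ne_top.2 hk0) ha) ?_
  rw [← ENNReal.tsum_mul_left]
  refine ENNReal.tsum_le_tsum fun n => ?_
  calc a n / ENNReal.ofReal (b' n) ≤ a n / (ENNReal.ofReal k * ENNReal.ofReal (b n)) := by
        rw [← ENNReal.ofReal_mul hk.le]
        exact ENNReal.div_le_div_left (ENNReal.ofReal_le_ofReal (hle n)) _
    _ = (ENNReal.ofReal k)⁻¹ * (a n / ENNReal.ofReal (b n)) := by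
        rw [div_eq_mul_inv, div_eq_mul_inv,
          ENNReal.mul_inv (Or.inl hk0) (Or.inl ENNReal.ofReal_ne_top)]
        ring

/-- mean-squared Taikov-type inequality.  Under conditions (B1)–(B4) on the
operators `B_0,…,B_m`, condition (A1) on the operator `A : H → X` (each basis vector lies in
`D(A)`), conditions (Af1) (`⟨f, A e_{n₀}⟩ ≠ 0` for some `n₀`) and (Af2) (the functional
`x ↦ ⟨f, A x⟩` with domain `D(A)` is closable), and the summability condition
`∑~_n |⟨f, A e_n⟩|² / b_{n,1} < ∞` (regularized sum, here expressed with the `ℝ≥0∞` division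
convention `a/0 = ∞` for `a ≠ 0`, `0/0 = 0`), for every positive weight vector `h` and every
`x ∈ D(A) ∩ H_B` one has
`|⟨f, A x⟩| ≤ (∑~_n |⟨f, A e_n⟩|² / b_{n,h})^{1/2} ⬝ ‖x‖_{B,h}`. -/
theorem statement2
    {H H' : Type*} [NormedAddCommGroup H] [InnerProductSpace ℂ H] [CompleteSpace H]
    [NormedAddCommGroup H'] [InnerProductSpace ℂ H'] [CompleteSpace H']
    {X : Type*} [NormedAddCommGroup X] [NormedSpace ℂ X]
    {ι : Type*} [Countable ι] (e : HilbertBasis ι ℂ H)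
    (m : ℕ) (B : Fin (m + 1) → H →ₗ.[ℂ] H')
    (hB1 : ∀ j n, e n ∈ (B j).domain)
    (hB2 : ∀ (j) (n n' : ι), n ≠ n' →
      ⟪(B j) ⟨e n, hB1 j n⟩, (B j) ⟨e n', hB1 j n'⟩⟫_ℂ = 0)
    (hB3 : ∃ j n, (B j) ⟨e n, hB1 j n⟩ ≠ 0)
    (hB4 : ∀ j, (B j).IsClosed)
    (A : H →ₗ.[ℂ] X) (f : X →L[ℂ] ℂ)
    (hA1 : ∀ n, e n ∈ A.domain)
    (hAf1 : ∃ n, f (A ⟨e n, hA1 n⟩) ≠ 0)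
    (hAf2 : ({ domain := A.domain,
               toFun := f.toLinearMap.comp A.toFun } : H →ₗ.[ℂ] ℂ).IsClosable)
    (hsum : (∑' n, (‖f (A ⟨e n, hA1 n⟩)‖₊ : ℝ≥0∞) ^ 2 /
        ENNReal.ofReal (∑ j, ‖(B j) ⟨e n, hB1 j n⟩‖ ^ 2)) ≠ ⊤) :
    ∀ (h : Fin (m + 1) → ℝ), (∀ j, 0 < h j) →
      ∀ (x : H) (hxA : x ∈ A.domain),
        (∀ j, Summable fun n => ‖e.repr x n‖ ^ 2 * ‖(B j) ⟨e n, hB1 j n⟩‖ ^ 2) →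
        ‖f (A ⟨x, hxA⟩)‖ ≤
          Real.sqrt (∑' n, (‖f (A ⟨e n, hA1 n⟩)‖₊ : ℝ≥0∞) ^ 2 /
              ENNReal.ofReal (∑ j, h j * ‖(B j) ⟨e n, hB1 j n⟩‖ ^ 2)).toReal *
          Real.sqrt (∑' n, ‖e.repr x n‖ ^ 2 *
              (∑ j, h j * ‖(B j) ⟨e n, hB1 j n⟩‖ ^ 2)) := by
  intro h hh x hxA hx
  obtain ⟨j₀, hj₀⟩ := Finite.exists_min h
  have hsum' := tsum_div_ofReal_ne_top_of_mul_le (hh j₀)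
    (b' := fun n => ∑ j, h j * ‖(B j) ⟨e n, hB1 j n⟩‖ ^ 2)
    (fun n => by
      rw [Finset.mul_sum]
      exact Finset.sum_le_sum fun j _ => mul_le_mul_of_nonneg_right (hj₀ j) (sq_nonneg _)) hsum
  have hsx : Summable fun n => ‖e.repr x n‖ ^ 2 *
      (∑ j, h j * ‖(B j) ⟨e n, hB1 j n⟩‖ ^ 2) := by
    simp_rw [Finset.mul_sum, mul_left_comm _ (h _) _]
    exact summable_sum fun j _ => (hx j).mul_left (h j)
  exact LinearPMap.norm_le_of_forall_sum_le e hAf2 hA1 ⟨x, hxA⟩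
    (sum_mul_le_sqrt_tsum_div_mul_sqrt_tsum
      (fun n => Finset.sum_nonneg fun j _ => mul_nonneg (hh j).le (sq_nonneg _))
      hsum' hsx)
end

section
/- Under conditions (B1)–(B4) for B_0,…,B_m, conditions (A1), (Af1), (Af2) for A and f ∈ X*, and the summability condition ∑~_{n∈M} |⟨f, A e_n⟩|² / b_{n,1} < ∞, the constant in the mean-squared Taikov inequality is sharp: for every h ∈ (0,∞)^{m+1}, sup { |⟨f, Ax⟩| / ‖x‖_{B,h} : x ∈ D(A) ∩ H_B, ‖x‖_{B,h} ≠ 0 } = ( ∑~_{n∈M} |⟨f, A e_n⟩|² / b_{n,h} )^{1/2}. In particular, the finite linear combinations x_{h,N} := ∑_{n∈M_N, b_{n,h}≠0} ( conj(⟨f, A e_n⟩) / b_{n,h} ) · e_n over an exhausting sequence of finite subsets M_N ↑ M satisfy |⟨f, A x_{h,N}⟩|² / ‖x_{h,N}‖²_{B,h} → ∑~_{n∈M} |⟨f, A e_n⟩|² / b_{n,h} as N → ∞. -/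
open scoped InnerProductSpace ENNReal NNReal

/-- A closable linear functional is continuous on its domain. -/
theorem LinearPMap.IsClosable.continuous_functional {H : Type*} [NormedAddCommGroup H]
    [NormedSpace ℂ H] {φ : H →ₗ.[ℂ] ℂ} (hφ : φ.IsClosable) : Continuous φ.toFun := by
  obtain ⟨ψ, hψ⟩ := hφ
  refine LinearMap.continuous_of_isClosed_ker _ (isClosed_of_closure_subset fun x hx => ?_)
  have hmem : ((x : H), (0 : ℂ)) ∈ φ.graph.topologicalClosure := by
    have hcont : Continuous fun y : φ.domain => ((y : H), (0 : ℂ)) := by fun_prop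
    refine map_mem_closure (f := fun y : φ.domain => ((y : H), (0 : ℂ))) hcont hx fun y hy => ?_
    exact (LinearPMap.mem_graph_iff φ).2 ⟨y, rfl, hy⟩
  have hmem' : ((x : H), φ x) ∈ φ.graph.topologicalClosure :=
    Submodule.le_topologicalClosure _ (φ.mem_graph x)
  rw [hψ] at hmem hmem'
  exact LinearPMap.mem_graph_snd_inj' ψ hmem' hmem rfl

/-- A continuous functional on a domain containing a Hilbert basis acts by the expansion in it. -/
theorem HilbertBasis.hasSum_repr_mul_functional {ι H : Type*} [NormedAddCommGroup H]
    [InnerProductSpace ℂ H] (e : HilbertBasis ι ℂ H) {φ : H →ₗ.[ℂ] ℂ}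
    (hφ : Continuous φ.toFun) (he : ∀ n, e n ∈ φ.domain) (x : φ.domain) :
    HasSum (fun n => e.repr x n * φ ⟨e n, he n⟩) (φ x) := by
  have hx : HasSum (fun n => e.repr x n • (⟨e n, he n⟩ : φ.domain)) x :=
    (Topology.IsInducing.hasSum_iff (g := φ.domain.subtype) Topology.IsInducing.subtypeVal _ _).1
      (e.hasSum_repr x)
  simpa only [Function.comp_def, map_smul, smul_eq_mul, LinearPMap.toFun_eq_coe] using
    hx.map φ.toFun hφ

/-- The weighted Cauchy–Schwarz inequality for series. -/
theorem norm_le_sqrt_mul_sqrt_of_hasSum {ι : Type*} {c g : ι → ℂ} {b : ι → ℝ} {z : ℂ}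
    (hb : ∀ n, 0 ≤ b n) (hg : ∀ n, b n = 0 → g n = 0) (hz : HasSum (fun n => c n * g n) z)
    (hc : Summable fun n => ‖c n‖ ^ 2 * b n) (hgb : Summable fun n => ‖g n‖ ^ 2 / b n) :
    ‖z‖ ≤ √(∑' n, ‖g n‖ ^ 2 / b n) * √(∑' n, ‖c n‖ ^ 2 * b n) := by
  have hc0 : ∀ n, 0 ≤ ‖c n‖ ^ 2 * b n := fun n => mul_nonneg (sq_nonneg _) (hb n)
  have hg0 : ∀ n, 0 ≤ ‖g n‖ ^ 2 / b n := fun n => div_nonneg (sq_nonneg _) (hb n)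
  refine le_of_tendsto hz.norm (Filter.Eventually.of_forall fun s => ?_)
  rw [← Real.sqrt_mul (tsum_nonneg hg0)]
  refine (norm_sum_le _ _).trans (Real.le_sqrt_of_sq_le ?_)
  have hsq : ∀ n ∈ s, ‖c n * g n‖ ^ 2 = ‖g n‖ ^ 2 / b n * (‖c n‖ ^ 2 * b n) := fun n _ => by
    rcases eq_or_ne (b n) 0 with h0 | h0
    · simp [h0, hg n h0]
    · rw [norm_mul]; field_simp
  exact (Finset.sum_sq_le_sum_mul_sum_of_sq_le_mul s (fun n _ => hg0 n) (fun n _ => hc0 n)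
    fun n hn => (hsq n hn).le).trans (mul_le_mul (hgb.sum_le_tsum s fun n _ => hg0 n)
      (hc.sum_le_tsum s fun n _ => hc0 n) (Finset.sum_nonneg fun n _ => hc0 n) (tsum_nonneg hg0))

/-- A finite regularized `ℝ≥0∞`-valued series is a convergent series of real numbers. -/
theorem regularized_tsum_toReal {ι : Type*} {g : ι → ℂ} {b : ι → ℝ} (hb : ∀ n, 0 ≤ b n)
    (hfin : (∑' n, (‖g n‖₊ : ℝ≥0∞) ^ 2 / ENNReal.ofReal (b n)) ≠ ⊤) :
    (∀ n, b n = 0 → g n = 0) ∧ HasSum (fun n => ‖g n‖ ^ 2 / b n)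
      (∑' n, (‖g n‖₊ : ℝ≥0∞) ^ 2 / ENNReal.ofReal (b n)).toReal := by
  constructor
  · intro n hn
    by_contra hg
    refine ENNReal.ne_top_of_tsum_ne_top hfin n ?_
    rw [hn, ENNReal.ofReal_zero, ENNReal.div_zero]
    simpa using hg
  · have hterm : ∀ n, ((‖g n‖₊ : ℝ≥0∞) ^ 2 / ENNReal.ofReal (b n)).toReal = ‖g n‖ ^ 2 / b n :=
      fun n => by
        rw [ENNReal.toReal_div, ENNReal.toReal_pow, ENNReal.toReal_ofReal (hb n)]; simp
    rw [ENNReal.tsum_toReal_eq (ENNReal.ne_top_of_tsum_ne_top hfin)]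
    simpa only [hterm] using ENNReal.hasSum_toReal hfin

/-- Changing positive weights preserves finiteness of the regularized series. -/
theorem regularized_tsum_ne_top_of_weights {ι κ : Type*} [Fintype κ] [Nonempty κ]
    {a : ι → ℝ≥0∞} {w : κ → ι → ℝ} (hw : ∀ j n, 0 ≤ w j n) {h : κ → ℝ} (hpos : ∀ j, 0 < h j)
    (hfin : (∑' n, a n / ENNReal.ofReal (∑ j, w j n)) ≠ ⊤) :
    (∑' n, a n / ENNReal.ofReal (∑ j, h j * w j n)) ≠ ⊤ := by
  obtain ⟨i, hi⟩ := Finite.exists_min h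
  have hi0 : ENNReal.ofReal (h i) ≠ 0 := by simpa using hpos i
  refine ne_top_of_le_ne_top (ENNReal.mul_ne_top (ENNReal.inv_ne_top.2 hi0) hfin) ?_
  rw [← ENNReal.tsum_mul_left]
  refine ENNReal.tsum_le_tsum fun n => ?_
  calc a n / ENNReal.ofReal (∑ j, h j * w j n)
      ≤ a n / (ENNReal.ofReal (h i) * ENNReal.ofReal (∑ j, w j n)) := by
        rw [← ENNReal.ofReal_mul (hpos i).le, Finset.mul_sum]
        gcongr with j
        exacts [hw j n, hi j]
    _ = (ENNReal.ofReal (h i))⁻¹ * (a n / ENNReal.ofReal (∑ j, w j n)) := by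
        rw [div_eq_mul_inv, div_eq_mul_inv,
          ENNReal.mul_inv (Or.inl hi0) (Or.inl ENNReal.ofReal_ne_top)]
        ring

/-- Coordinates of a finite linear combination of Hilbert basis vectors. -/
theorem HilbertBasis.repr_sum_smul {ι H : Type*} [DecidableEq ι] [NormedAddCommGroup H]
    [InnerProductSpace ℂ H] (e : HilbertBasis ι ℂ H) (s : Finset ι) (c : ι → ℂ) (n : ι) :
    e.repr (∑ k ∈ s, c k • e k) n = if n ∈ s then c n else 0 := by
  rw [e.repr_apply_apply, inner_sum]
  simp [inner_smul_right, orthonormal_iff_ite.1 e.orthonormal]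

/-- The truncated extremal element: if `x` has coordinates `conj (g n) / b n` on a finite set and
`0` elsewhere, the functional with coefficients `g` and the squared `b`-weighted norm agree on
it. -/
theorem extremal_truncation {ι : Type*} [DecidableEq ι] {c g : ι → ℂ} {b : ι → ℝ} {s : Finset ι}
    (hc : ∀ n, c n = if n ∈ s then (starRingEnd ℂ) (g n) / (b n : ℂ) else 0) :
    HasSum (fun n => c n * g n) ((∑ n ∈ s, ‖g n‖ ^ 2 / b n : ℝ) : ℂ) ∧
    HasSum (fun n => ‖c n‖ ^ 2 * b n) (∑ n ∈ s, ‖g n‖ ^ 2 / b n) := by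
  constructor
  · have hs : ∑ n ∈ s, c n * g n = ((∑ n ∈ s, ‖g n‖ ^ 2 / b n : ℝ) : ℂ) := by
      push_cast
      refine Finset.sum_congr rfl fun n hn => ?_
      rw [hc, if_pos hn, div_mul_eq_mul_div, Complex.conj_mul']
    rw [← hs]
    exact hasSum_sum_of_ne_finset_zero fun n hn => by simp [hc, hn]
  · have hs : ∑ n ∈ s, ‖c n‖ ^ 2 * b n = ∑ n ∈ s, ‖g n‖ ^ 2 / b n := by
      refine Finset.sum_congr rfl fun n hn => ?_
      rcases eq_or_ne (b n) 0 with h0 | h0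
      · simp [h0]
      · rw [hc, if_pos hn, norm_div, RCLike.norm_conj, Complex.norm_real, div_pow,
          Real.norm_eq_abs, sq_abs]
        field_simp
    rw [← hs]
    exact hasSum_sum_of_ne_finset_zero fun n hn => by simp [hc, hn]

/-- sharpness of the mean-squared Taikov-type inequality.  Under conditions
(B1)–(B4), (A1), (Af1), (Af2) and the summability condition
`∑~_n |⟨f, A e_n⟩|²/b_{n,1} < ∞`, for every positive weight vector `h` the best constant in
the Taikov inequality is attained:
`sup { |⟨f, A x⟩| / ‖x‖_{B,h} : x ∈ D(A) ∩ H_B, ‖x‖_{B,h} ≠ 0 } = (∑~_n |⟨f,Ae_n⟩|²/b_{n,h})^{1/2}`,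
and the finite combinations `x_{h,N} = ∑_{n ∈ M_N, b_{n,h} ≠ 0} (conj⟨f,Ae_n⟩/b_{n,h}) • e_n`
over an exhausting sequence `M_N ↑ M` of finite index sets satisfy
`|⟨f, A x_{h,N}⟩|²/‖x_{h,N}‖²_{B,h} → ∑~_n |⟨f,Ae_n⟩|²/b_{n,h}`. -/
theorem statement3
    {H H' : Type*} [NormedAddCommGroup H] [InnerProductSpace ℂ H] [CompleteSpace H]
    [NormedAddCommGroup H'] [InnerProductSpace ℂ H'] [CompleteSpace H']
    {X : Type*} [NormedAddCommGroup X] [NormedSpace ℂ X]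
    {ι : Type*} [Countable ι] (e : HilbertBasis ι ℂ H)
    (Mseq : ℕ → Finset ι) (hMmono : Monotone Mseq) (hMexh : ∀ n : ι, ∃ N, n ∈ Mseq N)
    (m : ℕ) (B : Fin (m + 1) → H →ₗ.[ℂ] H')
    (hB1 : ∀ j n, e n ∈ (B j).domain)
    (hB2 : ∀ (j) (n n' : ι), n ≠ n' →
      ⟪(B j) ⟨e n, hB1 j n⟩, (B j) ⟨e n', hB1 j n'⟩⟫_ℂ = 0)
    (hB3 : ∃ j n, (B j) ⟨e n, hB1 j n⟩ ≠ 0)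
    (hB4 : ∀ j, (B j).IsClosed)
    (A : H →ₗ.[ℂ] X) (f : X →L[ℂ] ℂ)
    (hA1 : ∀ n, e n ∈ A.domain)
    (hAf1 : ∃ n, f (A ⟨e n, hA1 n⟩) ≠ 0)
    (hAf2 : ({ domain := A.domain,
               toFun := f.toLinearMap.comp A.toFun } : H →ₗ.[ℂ] ℂ).IsClosable)
    (hsum : (∑' n, (‖f (A ⟨e n, hA1 n⟩)‖₊ : ℝ≥0∞) ^ 2 /
        ENNReal.ofReal (∑ j, ‖(B j) ⟨e n, hB1 j n⟩‖ ^ 2)) ≠ ⊤)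
    (h : Fin (m + 1) → ℝ) (hpos : ∀ j, 0 < h j) :
    sSup {r : ℝ | ∃ (x : H) (hxA : x ∈ A.domain),
        (∀ j, Summable fun n => ‖e.repr x n‖ ^ 2 * ‖(B j) ⟨e n, hB1 j n⟩‖ ^ 2) ∧
        (∑' n, ‖e.repr x n‖ ^ 2 * (∑ j, h j * ‖(B j) ⟨e n, hB1 j n⟩‖ ^ 2)) ≠ 0 ∧
        r = ‖f (A ⟨x, hxA⟩)‖ /
          Real.sqrt (∑' n, ‖e.repr x n‖ ^ 2 * (∑ j, h j * ‖(B j) ⟨e n, hB1 j n⟩‖ ^ 2))}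
      = Real.sqrt (∑' n, (‖f (A ⟨e n, hA1 n⟩)‖₊ : ℝ≥0∞) ^ 2 /
          ENNReal.ofReal (∑ j, h j * ‖(B j) ⟨e n, hB1 j n⟩‖ ^ 2)).toReal ∧
    ∀ xN : ℕ → H,
      (∀ N, xN N = ∑ n ∈ Mseq N,
        (if (∑ j, h j * ‖(B j) ⟨e n, hB1 j n⟩‖ ^ 2) = 0 then (0 : H)
         else ((starRingEnd ℂ) (f (A ⟨e n, hA1 n⟩)) /
            ((∑ j, h j * ‖(B j) ⟨e n, hB1 j n⟩‖ ^ 2 : ℝ) : ℂ)) • e n)) →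
      ∃ hmem : ∀ N, xN N ∈ A.domain,
        Filter.Tendsto (fun N => ‖f (A ⟨xN N, hmem N⟩)‖ ^ 2 /
            (∑' n, ‖e.repr (xN N) n‖ ^ 2 * (∑ j, h j * ‖(B j) ⟨e n, hB1 j n⟩‖ ^ 2)))
          Filter.atTop
          (nhds (∑' n, (‖f (A ⟨e n, hA1 n⟩)‖₊ : ℝ≥0∞) ^ 2 /
            ENNReal.ofReal (∑ j, h j * ‖(B j) ⟨e n, hB1 j n⟩‖ ^ 2)).toReal) := by
  classical
  set g : ι → ℂ := fun n => f (A ⟨e n, hA1 n⟩)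
  set b : ι → ℝ := fun n => ∑ j, h j * ‖(B j) ⟨e n, hB1 j n⟩‖ ^ 2 with hbdef
  have hb : ∀ n, 0 ≤ b n := fun n =>
    Finset.sum_nonneg fun j _ => mul_nonneg (hpos j).le (sq_nonneg _)
  have hfin : (∑' n, (‖g n‖₊ : ℝ≥0∞) ^ 2 / ENNReal.ofReal (b n)) ≠ ⊤ :=
    regularized_tsum_ne_top_of_weights (fun j n => sq_nonneg _) hpos hsum
  obtain ⟨hg, hS⟩ := regularized_tsum_toReal hb hfin
  set S : ℝ := (∑' n, (‖g n‖₊ : ℝ≥0∞) ^ 2 / ENNReal.ofReal (b n)).toReal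
  have hterm : ∀ n, 0 ≤ ‖g n‖ ^ 2 / b n := fun n => div_nonneg (sq_nonneg _) (hb n)
  have hSpos : 0 < S := by
    obtain ⟨n, hn⟩ := hAf1
    have hbn : 0 < b n := (hb n).lt_of_ne' fun h0 => hn (hg n h0)
    have hgn : 0 < ‖g n‖ := norm_pos_iff.2 hn
    exact (by positivity : 0 < ‖g n‖ ^ 2 / b n).trans_le (le_hasSum hS n fun k _ => hterm k)
  have hexp : ∀ (x : H) (hx : x ∈ A.domain),
      HasSum (fun n => e.repr x n * g n) (f (A ⟨x, hx⟩)) := fun x hx =>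
    e.hasSum_repr_mul_functional hAf2.continuous_functional hA1 ⟨x, hx⟩
  have hMtop : Filter.Tendsto Mseq Filter.atTop Filter.atTop :=
    Filter.tendsto_atTop_finset_of_monotone hMmono hMexh
  have hSN : Filter.Tendsto (fun N => ∑ n ∈ Mseq N, ‖g n‖ ^ 2 / b n) Filter.atTop (nhds S) :=
    hS.comp hMtop
  have hmem : ∀ (s : Finset ι) (c : ι → ℂ), ∑ n ∈ s, c n • e n ∈ A.domain := fun s c =>
    Submodule.sum_mem _ fun n _ => Submodule.smul_mem _ _ (hA1 n)
  have hval : ∀ (s : Finset ι) (x : H) (hx : x ∈ A.domain),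
      x = ∑ n ∈ s, ((starRingEnd ℂ) (g n) / (b n : ℂ)) • e n →
      f (A ⟨x, hx⟩) = ((∑ n ∈ s, ‖g n‖ ^ 2 / b n : ℝ) : ℂ) ∧
      ∑' n, ‖e.repr x n‖ ^ 2 * b n = ∑ n ∈ s, ‖g n‖ ^ 2 / b n := by
    intro s x hx hxs
    have key := extremal_truncation (c := fun n => e.repr x n) (s := s) fun n => by
      rw [hxs]
      exact e.repr_sum_smul s (fun n => (starRingEnd ℂ) (g n) / (b n : ℂ)) n
    exact ⟨(hexp x hx).unique key.1, key.2.tsum_eq⟩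
  have hsup : ∀ N, 0 < ∑ n ∈ Mseq N, ‖g n‖ ^ 2 / b n →
      ∃ (x : H) (hxA : x ∈ A.domain),
        (∀ j, Summable fun n => ‖e.repr x n‖ ^ 2 * ‖(B j) ⟨e n, hB1 j n⟩‖ ^ 2) ∧
        (∑' n, ‖e.repr x n‖ ^ 2 * b n) ≠ 0 ∧
        √(∑ n ∈ Mseq N, ‖g n‖ ^ 2 / b n) =
          ‖f (A ⟨x, hxA⟩)‖ / √(∑' n, ‖e.repr x n‖ ^ 2 * b n) := by
    intro N hN
    refine ⟨_, hmem (Mseq N) fun n => (starRingEnd ℂ) (g n) / (b n : ℂ), fun j => ?_, ?_⟩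
    · refine summable_of_ne_finset_zero (s := Mseq N) fun n hn => ?_
      rw [e.repr_sum_smul, if_neg hn]
      simp
    · obtain ⟨h1, h2⟩ := hval (Mseq N) _
        (hmem (Mseq N) fun n => (starRingEnd ℂ) (g n) / (b n : ℂ)) rfl
      rw [h1, h2, Complex.norm_real, Real.norm_of_nonneg hN.le, Real.div_sqrt]
      exact ⟨hN.ne', rfl⟩
  refine ⟨csSup_eq_of_forall_le_of_forall_lt_exists_gt ?_ ?_ ?_, ?_⟩
  · obtain ⟨N, hN⟩ := (hSN.eventually (lt_mem_nhds hSpos)).exists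
    exact ⟨_, hsup N hN⟩
  · rintro r ⟨x, hxA, hxB, -, rfl⟩
    have hxb : Summable fun n => ‖e.repr x n‖ ^ 2 * b n := by
      have := summable_sum fun j (_ : j ∈ Finset.univ) => (hxB j).mul_left (h j)
      refine this.congr fun n => ?_
      simp only [hbdef, Finset.mul_sum]
      exact Finset.sum_congr rfl fun j _ => by ring
    refine div_le_of_le_mul₀ (Real.sqrt_nonneg _) (Real.sqrt_nonneg _) ?_
    rw [← hS.tsum_eq]
    exact norm_le_sqrt_mul_sqrt_of_hasSum hb hg (hexp x hxA) hxb hS.summable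
  · intro w hw
    obtain ⟨N, hN, hwN⟩ := ((hSN.eventually (lt_mem_nhds hSpos)).and
      (hSN.sqrt.eventually (lt_mem_nhds hw))).exists
    exact ⟨_, hsup N hN, hwN⟩
  · intro xN hxN
    have hxN' : ∀ N, xN N = ∑ n ∈ Mseq N, ((starRingEnd ℂ) (g n) / (b n : ℂ)) • e n := by
      intro N
      rw [hxN N]
      refine Finset.sum_congr rfl fun n _ => ?_
      split_ifs with h0
      · rw [show b n = 0 from h0]
        simp
      · rfl
    refine ⟨fun N => hxN' N ▸ hmem _ _, hSN.congr fun N => ?_⟩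
    obtain ⟨h1, h2⟩ := hval (Mseq N) (xN N) (hxN' N ▸ hmem _ _) (hxN' N)
    rw [h1, h2, Complex.norm_real, Real.norm_eq_abs, sq_abs, sq, mul_self_div_self]
end

section
/- Let p, q ∈ ℤ≥0 and suppose both families C_0,…,C_p and D_0,…,D_q of operators from H to H' satisfy conditions (B1)–(B4), the operator A and functional f ∈ X* satisfy (A1), (Af1), (Af2), and ∑~_{n∈M} |⟨f, A e_n⟩|² / (c_{n,1'} + d_{n,1''}) < ∞. Then for all h' ∈ (0,∞)^{p+1}, h'' ∈ (0,∞)^{q+1}, writing b_{n,h} := c_{n,h'} + d_{n,h''}, for every x ∈ D(A) ∩ H_C ∩ H_D one has |⟨f, Ax⟩| ≤ ( ∑~_{n∈M} |⟨f, A e_n⟩|² c_{n,h'} / b_{n,h}² )^{1/2} ‖x‖_{C,h'} + ( ∑~_{n∈M} |⟨f, A e_n⟩|² d_{n,h''} / b_{n,h}² )^{1/2} ‖x‖_{D,h''}. -/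
open scoped InnerProductSpace ENNReal NNReal

/-- A closable linear functional with values in `ℂ` is continuous on its domain. -/
theorem LinearPMap.IsClosable.continuous_of_functional {E : Type*} [NormedAddCommGroup E]
    [InnerProductSpace ℂ E] {g : E →ₗ.[ℂ] ℂ} (hg : g.IsClosable) : Continuous g.toFun := by
  obtain ⟨g', hg'⟩ := hg
  refine LinearMap.continuous_of_isClosed_ker g.toFun ?_
  rw [← isSeqClosed_iff_isClosed]
  intro u x hu hux
  have h1 : ((x : E), (0 : ℂ)) ∈ g'.graph := by
    rw [← hg', ← SetLike.mem_coe, Submodule.topologicalClosure_coe]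
    refine mem_closure_of_tendsto (f := fun n => ((u n : E), (0 : ℂ))) (b := Filter.atTop)
      (((continuous_subtype_val.tendsto x).comp hux).prodMk_nhds tendsto_const_nhds)
      (Filter.Eventually.of_forall fun n => ?_)
    have h := g.mem_graph (u n)
    have h0 : g (u n) = 0 := hu n
    rwa [h0] at h
  have h2 : ((x : E), g x) ∈ g'.graph := by
    rw [← hg']
    exact Submodule.le_topologicalClosure _ (g.mem_graph x)
  have h3 : g x = 0 := g'.mem_graph_snd_inj h2 h1 rfl
  exact h3

/-- A functional continuous on its domain acts through the expansion in a Hilbert basis contained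
in the domain. -/
theorem HilbertBasis.hasSum_functional {E ι : Type*} [NormedAddCommGroup E]
    [InnerProductSpace ℂ E] (e : HilbertBasis ι ℂ E) {g : E →ₗ.[ℂ] ℂ}
    (hg : Continuous g.toFun) (he : ∀ n, e n ∈ g.domain) (x : g.domain) :
    HasSum (fun n => e.repr x n * g ⟨e n, he n⟩) (g x) := by
  have h1 : HasSum (fun n => e.repr x n • (⟨e n, he n⟩ : g.domain)) x := by
    have hi : Topology.IsInducing g.domain.subtype := Topology.IsInducing.subtypeVal
    rw [← hi.hasSum_iff]
    exact e.hasSum_repr x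
  have h2 := h1.map g.toFun hg
  have h3 : (g.toFun ∘ fun n => e.repr x n • (⟨e n, he n⟩ : g.domain)) =
      fun n => e.repr x n * g ⟨e n, he n⟩ := by
    funext n
    exact g.map_smul _ _
  rwa [h3] at h2

/-- Weighted Cauchy–Schwarz inequality, with the coefficient sum taken in `ℝ≥0∞`. -/
theorem tsum_mul_mul_div_le_sqrt_mul_sqrt {ι : Type*} {a : ι → ℝ≥0} {b c y : ι → ℝ}
    (hb : ∀ n, 0 ≤ b n) (hc : ∀ n, 0 ≤ c n) (hy : ∀ n, 0 ≤ y n)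
    (hS : ∑' n, (a n : ℝ≥0∞) ^ 2 * ENNReal.ofReal (c n) / ENNReal.ofReal (b n) ^ 2 ≠ ⊤)
    (hyc : Summable fun n => y n ^ 2 * c n) :
    Summable (fun n => y n * a n * (c n / b n)) ∧
      ∑' n, y n * a n * (c n / b n) ≤
        √(∑' n, (a n : ℝ≥0∞) ^ 2 * ENNReal.ofReal (c n) / ENNReal.ofReal (b n) ^ 2).toReal *
          √(∑' n, y n ^ 2 * c n) := by
  have hterm : ∀ n, ((a n : ℝ≥0∞) ^ 2 * ENNReal.ofReal (c n) / ENNReal.ofReal (b n) ^ 2).toReal =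
      (a n * √(c n) / b n) ^ (2 : ℝ) := by
    intro n
    rw [Real.rpow_two]
    simp [ENNReal.toReal_div, ENNReal.toReal_mul, ENNReal.toReal_pow, hb n, hc n, div_pow, mul_pow,
      Real.sq_sqrt]
  have hterm' : ∀ n, y n ^ 2 * c n = (y n * √(c n)) ^ (2 : ℝ) := by
    intro n
    rw [Real.rpow_two, mul_pow, Real.sq_sqrt (hc n)]
  have hprod : ∀ n, (a n * √(c n) / b n) * (y n * √(c n)) = y n * a n * (c n / b n) := by
    intro n
    have := Real.mul_self_sqrt (hc n)
    linear_combination (a n / b n * y n : ℝ) * this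
  have hsum := ENNReal.summable_toReal hS
  rw [ENNReal.tsum_toReal_eq (ENNReal.ne_top_of_tsum_ne_top hS)]
  simp only [hterm, hterm'] at hsum hyc ⊢
  have key := Real.summable_and_inner_le_Lp_mul_Lq_tsum_of_nonneg Real.HolderConjugate.two_two
    (f := fun n => a n * √(c n) / b n) (g := fun n => y n * √(c n))
    (fun n => div_nonneg (by positivity) (hb n)) (fun n => mul_nonneg (hy n) (by positivity))
    hsum hyc
  simpa only [hprod, ← Real.sqrt_eq_rpow] using key

/-- A positive lower bound for finitely many positive weights. -/
theorem exists_pos_forall_le_of_finite {κ : Type*} [Finite κ] {w : κ → ℝ} (hw : ∀ j, 0 < w j) :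
    ∃ m, 0 < m ∧ ∀ j, m ≤ w j := by
  cases isEmpty_or_nonempty κ
  · exact ⟨1, one_pos, fun j => isEmptyElim j⟩
  · obtain ⟨j, hj⟩ := Finite.exists_min w
    exact ⟨w j, hw j, hj⟩

/-- Finiteness of `∑ a² / b'` passes to `∑ a² c / b²` when `c ≤ b` and `b` dominates a positive
multiple of `b'`. -/
theorem tsum_sq_mul_div_sq_ne_top {ι : Type*} {a : ι → ℝ≥0} {b b' c : ι → ℝ} {m : ℝ} (hm : 0 < m)
    (hb : ∀ n, m * b' n ≤ b n) (hcb : ∀ n, c n ≤ b n)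
    (hS : ∑' n, (a n : ℝ≥0∞) ^ 2 / ENNReal.ofReal (b' n) ≠ ⊤) :
    ∑' n, (a n : ℝ≥0∞) ^ 2 * ENNReal.ofReal (c n) / ENNReal.ofReal (b n) ^ 2 ≠ ⊤ := by
  have hm' : ENNReal.ofReal m ≠ 0 := by simpa using hm
  refine ne_top_of_le_ne_top
    (ENNReal.mul_ne_top (ENNReal.inv_ne_top.2 hm') hS) ?_
  rw [← ENNReal.tsum_mul_left]
  refine ENNReal.tsum_le_tsum fun n => ?_
  have h1 : ENNReal.ofReal (c n) / ENNReal.ofReal (b n) ≤ 1 :=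
    ENNReal.div_le_of_le_mul (by simpa using ENNReal.ofReal_le_ofReal (hcb n))
  have h2 : (ENNReal.ofReal (b n))⁻¹ ≤ (ENNReal.ofReal m)⁻¹ * (ENNReal.ofReal (b' n))⁻¹ := by
    rw [← ENNReal.mul_inv (Or.inl hm') (Or.inl ENNReal.ofReal_ne_top),
      ← ENNReal.ofReal_mul hm.le]
    exact ENNReal.inv_le_inv.2 (ENNReal.ofReal_le_ofReal (hb n))
  calc (a n : ℝ≥0∞) ^ 2 * ENNReal.ofReal (c n) / ENNReal.ofReal (b n) ^ 2
      = (a n : ℝ≥0∞) ^ 2 * (ENNReal.ofReal (c n) / ENNReal.ofReal (b n)) *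
          (ENNReal.ofReal (b n))⁻¹ := by
        rw [div_eq_mul_inv, div_eq_mul_inv, ENNReal.inv_pow]
        ring
    _ ≤ (a n : ℝ≥0∞) ^ 2 * 1 * ((ENNReal.ofReal m)⁻¹ * (ENNReal.ofReal (b' n))⁻¹) := by gcongr
    _ = (ENNReal.ofReal m)⁻¹ * ((a n : ℝ≥0∞) ^ 2 / ENNReal.ofReal (b' n)) := by
        rw [div_eq_mul_inv]
        ring

/-- Additive splitting of a weighted series estimate into two Cauchy–Schwarz bounds. -/
theorem norm_le_sqrt_mul_sqrt_add_of_hasSum {ι : Type*} {a y : ι → ℂ} {s : ℂ} {b' c d : ι → ℝ}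
    {m : ℝ} (hs : HasSum (fun n => y n * a n) s) (hm : 0 < m) (hc : ∀ n, 0 ≤ c n)
    (hd : ∀ n, 0 ≤ d n) (hb : ∀ n, m * b' n ≤ c n + d n)
    (hS : ∑' n, (‖a n‖₊ : ℝ≥0∞) ^ 2 / ENNReal.ofReal (b' n) ≠ ⊤)
    (h0 : ∀ n, c n + d n = 0 → b' n = 0)
    (hyc : Summable fun n => ‖y n‖ ^ 2 * c n) (hyd : Summable fun n => ‖y n‖ ^ 2 * d n) :
    ‖s‖ ≤
      √(∑' n, (‖a n‖₊ : ℝ≥0∞) ^ 2 * ENNReal.ofReal (c n) /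
          ENNReal.ofReal (c n + d n) ^ 2).toReal * √(∑' n, ‖y n‖ ^ 2 * c n) +
      √(∑' n, (‖a n‖₊ : ℝ≥0∞) ^ 2 * ENNReal.ofReal (d n) /
          ENNReal.ofReal (c n + d n) ^ 2).toReal * √(∑' n, ‖y n‖ ^ 2 * d n) := by
  have hcd : ∀ n, 0 ≤ c n + d n := fun n => add_nonneg (hc n) (hd n)
  have ha : ∀ n, c n + d n = 0 → ‖a n‖₊ = 0 := by
    intro n hn
    by_contra hne
    refine ENNReal.ne_top_of_tsum_ne_top hS n ?_
    rw [h0 n hn, ENNReal.ofReal_zero, ENNReal.div_zero]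
    simpa using hne
  obtain ⟨sc, lc⟩ := tsum_mul_mul_div_le_sqrt_mul_sqrt hcd hc (fun n => norm_nonneg (y n))
    (tsum_sq_mul_div_sq_ne_top hm hb (fun n => le_add_of_nonneg_right (hd n)) hS) hyc
  obtain ⟨sd, ld⟩ := tsum_mul_mul_div_le_sqrt_mul_sqrt hcd hd (fun n => norm_nonneg (y n))
    (tsum_sq_mul_div_sq_ne_top hm hb (fun n => le_add_of_nonneg_left (hc n)) hS) hyd
  refine le_trans ?_ (add_le_add lc ld)
  rw [← sc.tsum_add sd, ← hs.tsum_eq]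
  refine tsum_of_norm_bounded (sc.add sd).hasSum fun n => ?_
  rw [norm_mul, ← mul_add, ← add_div]
  by_cases hn : c n + d n = 0
  · have : ‖a n‖ = 0 := congrArg NNReal.toReal (ha n hn)
    simp [this]
  · rw [div_self hn, mul_one, coe_nnnorm]
/-- additive Taikov-type inequality.  Let `C_0,…,C_p` and `D_0,…,D_q` be two
families of operators from `H` to `H'` each satisfying conditions (B1)–(B4), let `A` and
`f ∈ X*` satisfy (A1), (Af1), (Af2), and assume the regularized sum
`∑~_n |⟨f,Ae_n⟩|²/(c_{n,1'} + d_{n,1''})` is finite (expressed below via the `ℝ≥0∞` division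
convention).  Then for all positive weight vectors `h'`, `h''`, writing
`b_{n,h} = c_{n,h'} + d_{n,h''}`, for every `x ∈ D(A) ∩ H_C ∩ H_D` one has
`|⟨f,Ax⟩| ≤ (∑~_n |⟨f,Ae_n⟩|² c_{n,h'}/b_{n,h}²)^{1/2} ‖x‖_{C,h'}
          + (∑~_n |⟨f,Ae_n⟩|² d_{n,h''}/b_{n,h}²)^{1/2} ‖x‖_{D,h''}`. -/
theorem statement4
    {H H' : Type*} [NormedAddCommGroup H] [InnerProductSpace ℂ H] [CompleteSpace H]
    [NormedAddCommGroup H'] [InnerProductSpace ℂ H'] [CompleteSpace H']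
    {X : Type*} [NormedAddCommGroup X] [NormedSpace ℂ X]
    {ι : Type*} [Countable ι] (e : HilbertBasis ι ℂ H)
    (p q : ℕ) (C : Fin (p + 1) → H →ₗ.[ℂ] H') (D : Fin (q + 1) → H →ₗ.[ℂ] H')
    (hC1 : ∀ j n, e n ∈ (C j).domain)
    (hC2 : ∀ (j) (n n' : ι), n ≠ n' →
      ⟪(C j) ⟨e n, hC1 j n⟩, (C j) ⟨e n', hC1 j n'⟩⟫_ℂ = 0)
    (hC3 : ∃ j n, (C j) ⟨e n, hC1 j n⟩ ≠ 0)
    (hC4 : ∀ j, (C j).IsClosed)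
    (hD1 : ∀ j n, e n ∈ (D j).domain)
    (hD2 : ∀ (j) (n n' : ι), n ≠ n' →
      ⟪(D j) ⟨e n, hD1 j n⟩, (D j) ⟨e n', hD1 j n'⟩⟫_ℂ = 0)
    (hD3 : ∃ j n, (D j) ⟨e n, hD1 j n⟩ ≠ 0)
    (hD4 : ∀ j, (D j).IsClosed)
    (A : H →ₗ.[ℂ] X) (f : X →L[ℂ] ℂ)
    (hA1 : ∀ n, e n ∈ A.domain)
    (hAf1 : ∃ n, f (A ⟨e n, hA1 n⟩) ≠ 0)
    (hAf2 : ({ domain := A.domain,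
               toFun := f.toLinearMap.comp A.toFun } : H →ₗ.[ℂ] ℂ).IsClosable)
    (hsum : (∑' n, (‖f (A ⟨e n, hA1 n⟩)‖₊ : ℝ≥0∞) ^ 2 /
        ENNReal.ofReal ((∑ j, ‖(C j) ⟨e n, hC1 j n⟩‖ ^ 2) +
          (∑ j, ‖(D j) ⟨e n, hD1 j n⟩‖ ^ 2))) ≠ ⊤) :
    ∀ (h' : Fin (p + 1) → ℝ), (∀ j, 0 < h' j) →
    ∀ (h'' : Fin (q + 1) → ℝ), (∀ j, 0 < h'' j) →
    ∀ (x : H) (hxA : x ∈ A.domain),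
      (∀ j, Summable fun n => ‖e.repr x n‖ ^ 2 * ‖(C j) ⟨e n, hC1 j n⟩‖ ^ 2) →
      (∀ j, Summable fun n => ‖e.repr x n‖ ^ 2 * ‖(D j) ⟨e n, hD1 j n⟩‖ ^ 2) →
      ‖f (A ⟨x, hxA⟩)‖ ≤
        Real.sqrt (∑' n, (‖f (A ⟨e n, hA1 n⟩)‖₊ : ℝ≥0∞) ^ 2 *
            ENNReal.ofReal (∑ j, h' j * ‖(C j) ⟨e n, hC1 j n⟩‖ ^ 2) /
            ENNReal.ofReal ((∑ j, h' j * ‖(C j) ⟨e n, hC1 j n⟩‖ ^ 2) +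
              (∑ j, h'' j * ‖(D j) ⟨e n, hD1 j n⟩‖ ^ 2)) ^ 2).toReal *
          Real.sqrt (∑' n, ‖e.repr x n‖ ^ 2 * (∑ j, h' j * ‖(C j) ⟨e n, hC1 j n⟩‖ ^ 2)) +
        Real.sqrt (∑' n, (‖f (A ⟨e n, hA1 n⟩)‖₊ : ℝ≥0∞) ^ 2 *
            ENNReal.ofReal (∑ j, h'' j * ‖(D j) ⟨e n, hD1 j n⟩‖ ^ 2) /
            ENNReal.ofReal ((∑ j, h' j * ‖(C j) ⟨e n, hC1 j n⟩‖ ^ 2) +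
              (∑ j, h'' j * ‖(D j) ⟨e n, hD1 j n⟩‖ ^ 2)) ^ 2).toReal *
          Real.sqrt (∑' n, ‖e.repr x n‖ ^ 2 * (∑ j, h'' j * ‖(D j) ⟨e n, hD1 j n⟩‖ ^ 2)) := by
  intro h' hh' h'' hh'' x hxA hxC hxD
  obtain ⟨m₁, hm₁, hm₁h⟩ := exists_pos_forall_le_of_finite hh'
  obtain ⟨m₂, hm₂, hm₂h⟩ := exists_pos_forall_le_of_finite hh''
  have hm : 0 < min m₁ m₂ := lt_min hm₁ hm₂
  have hb : ∀ n, min m₁ m₂ * ((∑ j, ‖(C j) ⟨e n, hC1 j n⟩‖ ^ 2) +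
      (∑ j, ‖(D j) ⟨e n, hD1 j n⟩‖ ^ 2)) ≤ (∑ j, h' j * ‖(C j) ⟨e n, hC1 j n⟩‖ ^ 2) +
      (∑ j, h'' j * ‖(D j) ⟨e n, hD1 j n⟩‖ ^ 2) := by
    intro n
    rw [mul_add, Finset.mul_sum, Finset.mul_sum]
    refine add_le_add (Finset.sum_le_sum fun j _ => ?_) (Finset.sum_le_sum fun j _ => ?_)
    · exact mul_le_mul_of_nonneg_right ((min_le_left _ _).trans (hm₁h j)) (sq_nonneg _)
    · exact mul_le_mul_of_nonneg_right ((min_le_right _ _).trans (hm₂h j)) (sq_nonneg _)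
  refine norm_le_sqrt_mul_sqrt_add_of_hasSum
    (e.hasSum_functional hAf2.continuous_of_functional hA1 ⟨x, hxA⟩) hm
    (fun n => Finset.sum_nonneg fun j _ => mul_nonneg (hh' j).le (sq_nonneg _))
    (fun n => Finset.sum_nonneg fun j _ => mul_nonneg (hh'' j).le (sq_nonneg _)) hb hsum
    (fun n hn => ?_) ?_ ?_
  · have h0 : 0 ≤ (∑ j, ‖(C j) ⟨e n, hC1 j n⟩‖ ^ 2) + (∑ j, ‖(D j) ⟨e n, hD1 j n⟩‖ ^ 2) := by
      positivity
    exact le_antisymm (nonpos_of_mul_nonpos_right ((hb n).trans_eq hn) hm) h0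
  · simp only [Finset.mul_sum, mul_left_comm]
    exact summable_sum fun j _ => (hxC j).mul_left (h' j)
  · simp only [Finset.mul_sum, mul_left_comm]
    exact summable_sum fun j _ => (hxD j).mul_left (h'' j)
end

section
/- Let X, Y be normed spaces, A : X → Y a homogeneous operator with domain D(A) (A(λx) = λ·Ax for scalars λ and x ∈ D(A)), and W ⊆ D(A) a centrally symmetric convex set. Then: (i) for every N ≥ 0, E_N(A; W) ≥ sup_{x∈W} ( ‖Ax‖_Y − N ‖x‖_X ). (ii) If there exist x₀ ∈ W and a bounded linear operator S₀ : X → Y such that ‖A x₀‖_Y = U(A, S₀; W) + ‖S₀‖ · ‖x₀‖_X, then E_{‖S₀‖}(A; W) = U(A, S₀; W) = ‖A x₀‖_Y − ‖S₀‖ · ‖x₀‖_X. -/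
open scoped ENNReal NNReal

/-- The reverse triangle inequality for approximating the value `y` by an operator of norm at most
`N` evaluated at `x`. -/
theorem ofReal_norm_sub_mul_norm_le_nnnorm_sub
    {𝕜 X Y : Type*} [NontriviallyNormedField 𝕜] [SeminormedAddCommGroup X] [NormedSpace 𝕜 X]
    [SeminormedAddCommGroup Y] [NormedSpace 𝕜 Y] {N : ℝ} {S : X →L[𝕜] Y} (hS : ‖S‖ ≤ N)
    (x : X) (y : Y) :
    ENNReal.ofReal (‖y‖ - N * ‖x‖) ≤ (‖y - S x‖₊ : ENNReal) := by
  rw [← enorm_eq_nnnorm, ← ofReal_norm]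
  apply ENNReal.ofReal_le_ofReal
  linarith [norm_sub_norm_le y (S x), S.le_of_opNorm_le hS x]

/-- Stechkin's lemma.  Let `X, Y` be normed spaces, `A` a homogeneous operator
with domain `DA`, and `W ⊆ DA` a centrally symmetric convex set.  With
`U(A,S;W) = ⨆_{x ∈ W} ‖Ax - Sx‖` and `E_N(A;W) = ⨅_{‖S‖ ≤ N} U(A,S;W)` (computed in `ℝ≥0∞`):
(i) for every `N ≥ 0`, `E_N(A;W) ≥ ⨆_{x ∈ W} (‖Ax‖ - N‖x‖)`;
(ii) if `x₀ ∈ W` and a bounded operator `S₀` satisfy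
`‖Ax₀‖ = U(A,S₀;W) + ‖S₀‖·‖x₀‖`, then
`E_{‖S₀‖}(A;W) = U(A,S₀;W) = ‖Ax₀‖ - ‖S₀‖·‖x₀‖`. -/
theorem statement5
    {X Y : Type*} [NormedAddCommGroup X] [NormedSpace ℂ X]
    [NormedAddCommGroup Y] [NormedSpace ℂ Y]
    (DA : Set X) (A : X → Y)
    (hhom : ∀ (c : ℂ) (x : X), x ∈ DA → c • x ∈ DA ∧ A (c • x) = c • A x)
    (W : Set X) (hWD : W ⊆ DA)
    (hWsymm : ∀ x ∈ W, -x ∈ W) (hWconv : Convex ℝ W) :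
    (∀ N : ℝ, 0 ≤ N →
      (⨆ x ∈ W, ENNReal.ofReal (‖A x‖ - N * ‖x‖)) ≤
        ⨅ (S : X →L[ℂ] Y) (_ : ‖S‖ ≤ N), ⨆ x ∈ W, (‖A x - S x‖₊ : ℝ≥0∞)) ∧
    (∀ (x₀ : X), x₀ ∈ W → ∀ S₀ : X →L[ℂ] Y,
      ENNReal.ofReal ‖A x₀‖ =
          (⨆ x ∈ W, (‖A x - S₀ x‖₊ : ℝ≥0∞)) + ENNReal.ofReal (‖S₀‖ * ‖x₀‖) →
      (⨅ (S : X →L[ℂ] Y) (_ : ‖S‖ ≤ ‖S₀‖), ⨆ x ∈ W, (‖A x - S x‖₊ : ℝ≥0∞)) =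
          (⨆ x ∈ W, (‖A x - S₀ x‖₊ : ℝ≥0∞)) ∧
        (⨆ x ∈ W, (‖A x - S₀ x‖₊ : ℝ≥0∞)) =
          ENNReal.ofReal (‖A x₀‖ - ‖S₀‖ * ‖x₀‖)) := by
  have lower_bound : ∀ N : ℝ,
      (⨆ x ∈ W, ENNReal.ofReal (‖A x‖ - N * ‖x‖)) ≤
        ⨅ (S : X →L[ℂ] Y) (_ : ‖S‖ ≤ N), ⨆ x ∈ W, (‖A x - S x‖₊ : ℝ≥0∞) := fun N =>
    le_iInf₂ fun S hS => iSup₂_mono fun x _ =>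
      ofReal_norm_sub_mul_norm_le_nnnorm_sub hS x (A x)
  refine ⟨fun N _ => lower_bound N, fun x₀ hx₀ S₀ h => ?_⟩
  have hU : (⨆ x ∈ W, (‖A x - S₀ x‖₊ : ℝ≥0∞)) =
      ENNReal.ofReal (‖A x₀‖ - ‖S₀‖ * ‖x₀‖) := by
    rw [ENNReal.ofReal_sub _ (by positivity), h, ENNReal.add_sub_cancel_right ENNReal.ofReal_ne_top]
  refine ⟨le_antisymm (iInf₂_le S₀ (le_refl ‖S₀‖)) ?_, hU⟩
  rw [hU]
  exact (le_iSup₂ (f := fun x (_ : x ∈ W) => ENNReal.ofReal (‖A x‖ - ‖S₀‖ * ‖x‖)) x₀ hx₀).trans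
    (lower_bound ‖S₀‖)
end

section
/- Let X = H', suppose B_0,…,B_m satisfy (B1)–(B4) and A : H → H' satisfies (A1) e_n ∈ D(A), (A2) A e_{n₀} ≠ 0 for some n₀, (A3) A is closable. Let λ_0,…,λ_m > 0 with λ_0 + … + λ_m = 1, and suppose the constant ℭ := sup_{h ∈ (0,∞)^{m+1}} ( ∏_{j=0}^m h_j^{λ_j} · sup_{f ∈ H', ‖f‖_{H'} ≤ 1} ∑~_{n∈M} |(f, A e_n)_{H'}|² / b_{n,h} ) is finite. Then for every x ∈ D(A) ∩ H_B one has the sharp multiplicative Hardy–Littlewood–Pólya-type inequality ‖Ax‖_{H'} ≤ sqrt( ℭ · ∏_{j=0}^m λ_j^{−λ_j} ) · ∏_{j=0}^m ‖B_j x‖_{H'}^{λ_j}. -/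
open scoped InnerProductSpace ENNReal NNReal

/-- A closable operator whose domain contains a Hilbert basis can be evaluated termwise on an
expansion in that basis whenever the image series converges. -/
lemma LinearPMap.IsClosable.apply_eq_of_hasSum_repr {H H' ι : Type*}
    [NormedAddCommGroup H] [InnerProductSpace ℂ H] [NormedAddCommGroup H'] [InnerProductSpace ℂ H']
    {T : H →ₗ.[ℂ] H'} (hT : T.IsClosable) (e : HilbertBasis ι ℂ H) (he : ∀ n, e n ∈ T.domain)
    {x : H} (hx : x ∈ T.domain) {y : H'}
    (hy : HasSum (fun n => e.repr x n • T ⟨e n, he n⟩) y) :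
    T ⟨x, hx⟩ = y := by
  obtain ⟨T', hT'⟩ := hT
  have hmem : (x, y) ∈ T.graph.topologicalClosure := by
    refine T.graph.isClosed_topologicalClosure.mem_of_tendsto ((e.hasSum_repr x).prodMk hy)
      (Filter.Eventually.of_forall fun s => ?_)
    exact Submodule.sum_mem _ fun n _ => T.graph.le_topologicalClosure
      (T.graph.smul_mem (e.repr x n) (T.mem_graph ⟨e n, he n⟩))
  have hmem' : (x, T ⟨x, hx⟩) ∈ T.graph.topologicalClosure :=
    T.graph.le_topologicalClosure (T.mem_graph ⟨x, hx⟩)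
  rw [hT'] at hmem hmem'
  exact T'.mem_graph_snd_inj hmem' hmem rfl

/-- A series is summable when the squared norms of its finite sums are dominated by the
corresponding finite sums of a summable family, up to a constant. -/
lemma summable_of_norm_sum_sq_le {E ι : Type*} [NormedAddCommGroup E] [CompleteSpace E]
    {v : ι → E} {w : ι → ℝ} {C : ℝ} (hC : 0 ≤ C) (hw : Summable w)
    (h : ∀ s : Finset ι, ‖∑ n ∈ s, v n‖ ^ 2 ≤ C * ∑ n ∈ s, w n) : Summable v := by
  rw [summable_iff_vanishing_norm]
  intro ε hε
  obtain ⟨s, hs⟩ := summable_iff_vanishing_norm.1 hw (ε ^ 2 / (C + 1)) (by positivity)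
  refine ⟨s, fun t ht => ?_⟩
  have h1 := (le_abs_self _).trans_lt (hs t ht)
  rw [lt_div_iff₀ (by positivity)] at h1
  have h2 := h t
  have h3 : 0 < ε ^ 2 := by positivity
  refine lt_of_pow_lt_pow_left₀ 2 hε.le ?_
  rcases le_or_gt 0 (∑ n ∈ t, w n) with h0 | h0
  · nlinarith
  · nlinarith [mul_nonneg hC (neg_nonneg.2 h0.le)]

lemma norm_sum_sq_of_pairwise_inner_eq_zero {E ι : Type*} [NormedAddCommGroup E]
    [InnerProductSpace ℂ E] {v : ι → E} (hv : ∀ i j, i ≠ j → ⟪v i, v j⟫_ℂ = 0) (s : Finset ι) :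
    ‖∑ n ∈ s, v n‖ ^ 2 = ∑ n ∈ s, ‖v n‖ ^ 2 := by
  classical
  induction s using Finset.induction_on with
  | empty => simp
  | insert a s ha ih =>
    rw [Finset.sum_insert ha, Finset.sum_insert ha, ← ih]
    have h0 : ⟪v a, ∑ n ∈ s, v n⟫_ℂ = 0 := by
      rw [inner_sum]
      exact Finset.sum_eq_zero fun n hn => hv _ _ fun h => ha (h ▸ hn)
    simpa only [sq] using norm_add_sq_eq_norm_sq_add_norm_sq_of_inner_eq_zero _ _ h0

/-- Duality form of the weighted Cauchy–Schwarz inequality for finite sums of vectors. -/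
lemma norm_sum_smul_sq_le_of_tsum_inner_sq_div_le {E ι : Type*} [NormedAddCommGroup E]
    [InnerProductSpace ℂ E] {a : ι → E} {b : ι → ℝ} (hb : ∀ n, 0 ≤ b n) {K : ℝ≥0∞} (hK : K ≠ ⊤)
    (h : ∀ f : E, ‖f‖ ≤ 1 → ∑' n, (‖⟪f, a n⟫_ℂ‖₊ : ℝ≥0∞) ^ 2 / ENNReal.ofReal (b n) ≤ K)
    (c : ι → ℂ) (s : Finset ι) :
    ‖∑ n ∈ s, c n • a n‖ ^ 2 ≤ K.toReal * ∑ n ∈ s, ‖c n‖ ^ 2 * b n := by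
  have key : ∀ f : E, ‖f‖ ≤ 1 →
      ‖⟪f, ∑ n ∈ s, c n • a n⟫_ℂ‖ ^ 2 ≤ K.toReal * ∑ n ∈ s, ‖c n‖ ^ 2 * b n := by
    intro f hf
    have hterm : ∀ n, (‖⟪f, a n⟫_ℂ‖₊ : ℝ≥0∞) ^ 2 / ENNReal.ofReal (b n) ≠ ⊤ := fun n =>
      ne_top_of_le_ne_top hK ((ENNReal.le_tsum n).trans (h f hf))
    have hzero : ∀ n, b n = 0 → ⟪f, a n⟫_ℂ = 0 := by
      intro n hn
      by_contra hne
      refine hterm n ?_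
      rw [hn, ENNReal.ofReal_zero, ENNReal.div_zero]
      simpa using hne
    have hreal : ∀ n, ((‖⟪f, a n⟫_ℂ‖₊ : ℝ≥0∞) ^ 2 / ENNReal.ofReal (b n)).toReal =
        ‖⟪f, a n⟫_ℂ‖ ^ 2 / b n := by
      intro n
      simp [ENNReal.toReal_div, ENNReal.toReal_ofReal (hb n)]
    have hq : ∑ n ∈ s, ‖⟪f, a n⟫_ℂ‖ ^ 2 / b n ≤ K.toReal := by
      simp_rw [← hreal]
      rw [← ENNReal.toReal_sum fun n _ => hterm n]
      exact ENNReal.toReal_mono hK ((ENNReal.sum_le_tsum s).trans (h f hf))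
    have hle : ‖⟪f, ∑ n ∈ s, c n • a n⟫_ℂ‖ ≤ ∑ n ∈ s, ‖c n‖ * ‖⟪f, a n⟫_ℂ‖ := by
      rw [inner_sum]
      refine (norm_sum_le _ _).trans_eq (Finset.sum_congr rfl fun n _ => ?_)
      rw [inner_smul_right, norm_mul]
    have hcs : (∑ n ∈ s, ‖c n‖ * ‖⟪f, a n⟫_ℂ‖) ^ 2 ≤
        (∑ n ∈ s, ‖⟪f, a n⟫_ℂ‖ ^ 2 / b n) * ∑ n ∈ s, ‖c n‖ ^ 2 * b n := by
      refine Finset.sum_sq_le_sum_mul_sum_of_sq_le_mul s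
        (fun n _ => div_nonneg (sq_nonneg _) (hb n))
        (fun n _ => mul_nonneg (sq_nonneg _) (hb n)) fun n _ => ?_
      by_cases hn : b n = 0
      · simp [hn, hzero n hn]
      · field_simp
        rfl
    calc _ ≤ (∑ n ∈ s, ‖c n‖ * ‖⟪f, a n⟫_ℂ‖) ^ 2 := by gcongr
      _ ≤ _ := hcs
      _ ≤ _ := by
        gcongr
        exact Finset.sum_nonneg fun n _ => mul_nonneg (sq_nonneg _) (hb n)
  set u := ∑ n ∈ s, c n • a n with hu
  by_cases hu0 : u = 0
  · simpa [hu0] using key 0 (by simp)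
  · have h1 := key ((‖u‖⁻¹ : ℂ) • u) (by
      rw [norm_smul, norm_inv, Complex.norm_real, norm_norm, inv_mul_cancel₀ (by simpa using hu0)])
    have hne : (‖u‖ : ℂ) ≠ 0 := by simpa using hu0
    have h2 : ⟪(‖u‖⁻¹ : ℂ) • u, u⟫_ℂ = ‖u‖ := by
      rw [inner_smul_left, inner_self_eq_norm_sq_to_K]
      simp only [map_inv₀, Complex.conj_ofReal, Complex.coe_algebraMap]
      field_simp
    rw [h2, Complex.norm_real, norm_norm] at h1
    exact h1

/-- multiplicative Hardy–Littlewood–Pólya-type inequality.  Let `X = H'`,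
let `B_0,…,B_m` satisfy (B1)–(B4), let `A : H → H'` satisfy (A1)–(A3), let `λ_0,…,λ_m > 0` sum
to `1`, and suppose the constant
`ℭ = sup_{h>0} ∏_j h_j^{λ_j} sup_{‖f‖≤1} ∑~_n |(f,Ae_n)|²/b_{n,h}` (computed in `ℝ≥0∞`) is
finite.  Then for every `x ∈ D(A) ∩ H_B`,
`‖Ax‖ ≤ sqrt(ℭ ∏_j λ_j^{-λ_j}) ∏_j ‖B_j x‖^{λ_j}`. -/
theorem statement11
    {H H' : Type*} [NormedAddCommGroup H] [InnerProductSpace ℂ H] [CompleteSpace H]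
    [NormedAddCommGroup H'] [InnerProductSpace ℂ H'] [CompleteSpace H']
    {ι : Type*} [Countable ι] (e : HilbertBasis ι ℂ H)
    (m : ℕ) (B : Fin (m + 1) → H →ₗ.[ℂ] H')
    (hB1 : ∀ j n, e n ∈ (B j).domain)
    (hB2 : ∀ (j) (n n' : ι), n ≠ n' →
      ⟪(B j) ⟨e n, hB1 j n⟩, (B j) ⟨e n', hB1 j n'⟩⟫_ℂ = 0)
    (hB3 : ∃ j n, (B j) ⟨e n, hB1 j n⟩ ≠ 0)
    (hB4 : ∀ j, (B j).IsClosed)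
    (A : H →ₗ.[ℂ] H')
    (hA1 : ∀ n, e n ∈ A.domain)
    (hA2 : ∃ n, A ⟨e n, hA1 n⟩ ≠ 0)
    (hA3 : A.IsClosable)
    (lam : Fin (m + 1) → ℝ) (hlam : ∀ j, 0 < lam j) (hlam1 : ∑ j, lam j = 1)
    (hC : (⨆ (h : Fin (m + 1) → ℝ) (_ : ∀ j, 0 < h j),
        (∏ j, ENNReal.ofReal (h j ^ lam j)) *
          ⨆ (f : H') (_ : ‖f‖ ≤ 1),
            ∑' n, (‖⟪f, A ⟨e n, hA1 n⟩⟫_ℂ‖₊ : ℝ≥0∞) ^ 2 /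
              ENNReal.ofReal (∑ j, h j * ‖(B j) ⟨e n, hB1 j n⟩‖ ^ 2)) ≠ ⊤) :
    ∀ (x : H) (hxA : x ∈ A.domain) (hxB : ∀ j, x ∈ (B j).domain),
      (∀ j, Summable fun n => ‖e.repr x n‖ ^ 2 * ‖(B j) ⟨e n, hB1 j n⟩‖ ^ 2) →
      ‖A ⟨x, hxA⟩‖ ≤
        Real.sqrt ((⨆ (h : Fin (m + 1) → ℝ) (_ : ∀ j, 0 < h j),
            (∏ j, ENNReal.ofReal (h j ^ lam j)) *
              ⨆ (f : H') (_ : ‖f‖ ≤ 1),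
                ∑' n, (‖⟪f, A ⟨e n, hA1 n⟩⟫_ℂ‖₊ : ℝ≥0∞) ^ 2 /
                  ENNReal.ofReal (∑ j, h j * ‖(B j) ⟨e n, hB1 j n⟩‖ ^ 2)).toReal *
          ∏ j, lam j ^ (-(lam j))) *
        ∏ j, ‖(B j) ⟨x, hxB j⟩‖ ^ lam j := by
  intro x hxA hxB hsum
  generalize hCdef : (⨆ (h : Fin (m + 1) → ℝ) (_ : ∀ j, 0 < h j),
        (∏ j, ENNReal.ofReal (h j ^ lam j)) *
          ⨆ (f : H') (_ : ‖f‖ ≤ 1),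
            ∑' n, (‖⟪f, A ⟨e n, hA1 n⟩⟫_ℂ‖₊ : ℝ≥0∞) ^ 2 /
              ENNReal.ofReal (∑ j, h j * ‖(B j) ⟨e n, hB1 j n⟩‖ ^ 2)) = C at hC ⊢
  have hB : ∀ j, HasSum (fun n => ‖e.repr x n‖ ^ 2 * ‖(B j) ⟨e n, hB1 j n⟩‖ ^ 2)
      (‖(B j) ⟨x, hxB j⟩‖ ^ 2) := by
    intro j
    have hfin := norm_sum_sq_of_pairwise_inner_eq_zero
      (v := fun n => e.repr x n • (B j) ⟨e n, hB1 j n⟩) (fun n n' hne => by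
        simp only [inner_smul_left, inner_smul_right, hB2 j n n' hne, mul_zero])
    simp only [norm_smul, mul_pow] at hfin
    have hsm : Summable fun n => e.repr x n • (B j) ⟨e n, hB1 j n⟩ :=
      summable_of_norm_sum_sq_le zero_le_one (hsum j) fun s => by rw [one_mul, hfin]
    have heq := (hB4 j).isClosable.apply_eq_of_hasSum_repr e (hB1 j) (hxB j) hsm.hasSum
    rw [heq]
    have ht := (hsm.hasSum.norm.pow 2)
    simp only [hfin] at ht
    exact ht
  have hmain : ∀ h : Fin (m + 1) → ℝ, (∀ j, 0 < h j) →
      (∏ j, h j ^ lam j) * ‖A ⟨x, hxA⟩‖ ^ 2 ≤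
        C.toReal * ∑ j, h j * ‖(B j) ⟨x, hxB j⟩‖ ^ 2 := by
    intro h hh
    set K : ℝ≥0∞ := ⨆ (f : H') (_ : ‖f‖ ≤ 1),
      ∑' n, (‖⟪f, A ⟨e n, hA1 n⟩⟫_ℂ‖₊ : ℝ≥0∞) ^ 2 /
        ENNReal.ofReal (∑ j, h j * ‖(B j) ⟨e n, hB1 j n⟩‖ ^ 2) with hKdef
    have hP : 0 < ∏ j, h j ^ lam j := Finset.prod_pos fun j _ => Real.rpow_pos_of_pos (hh j) _
    have hPK : ENNReal.ofReal (∏ j, h j ^ lam j) * K ≤ C := by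
      rw [← hCdef, ENNReal.ofReal_prod_of_nonneg fun j _ => (Real.rpow_pos_of_pos (hh j) _).le]
      exact le_iSup₂_of_le h hh le_rfl
    have hK : K ≠ ⊤ := by
      intro hK
      rw [hK, ENNReal.mul_top (by simpa using hP)] at hPK
      exact hC (top_le_iff.1 hPK)
    have hPK' : (∏ j, h j ^ lam j) * K.toReal ≤ C.toReal := by
      have := ENNReal.toReal_mono hC hPK
      rwa [ENNReal.toReal_mul, ENNReal.toReal_ofReal hP.le] at this
    have hfin := norm_sum_smul_sq_le_of_tsum_inner_sq_div_le
      (a := fun n => A ⟨e n, hA1 n⟩)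
      (b := fun n => ∑ j, h j * ‖(B j) ⟨e n, hB1 j n⟩‖ ^ 2)
      (fun n => Finset.sum_nonneg fun j _ => mul_nonneg (hh j).le (sq_nonneg _)) hK
      (fun f hf => by rw [hKdef]; exact le_iSup₂_of_le f hf le_rfl) (e.repr x)
    have hw : HasSum (fun n => ‖e.repr x n‖ ^ 2 * ∑ j, h j * ‖(B j) ⟨e n, hB1 j n⟩‖ ^ 2)
        (∑ j, h j * ‖(B j) ⟨x, hxB j⟩‖ ^ 2) := by
      simp_rw [Finset.mul_sum, mul_left_comm]
      exact hasSum_sum fun j _ => (hB j).mul_left (h j)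
    have hsm := summable_of_norm_sum_sq_le ENNReal.toReal_nonneg hw.summable hfin
    have heq := hA3.apply_eq_of_hasSum_repr e hA1 hxA hsm.hasSum
    have hle : ‖A ⟨x, hxA⟩‖ ^ 2 ≤ K.toReal * ∑ j, h j * ‖(B j) ⟨x, hxB j⟩‖ ^ 2 := by
      rw [heq]
      exact le_of_tendsto_of_tendsto' (hsm.hasSum.norm.pow 2)
        (Filter.Tendsto.const_mul _ hw) hfin
    calc _ ≤ (∏ j, h j ^ lam j) * (K.toReal * ∑ j, h j * ‖(B j) ⟨x, hxB j⟩‖ ^ 2) := by gcongr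
      _ = ((∏ j, h j ^ lam j) * K.toReal) * ∑ j, h j * ‖(B j) ⟨x, hxB j⟩‖ ^ 2 := by ring
      _ ≤ _ := by
        gcongr
        exact Finset.sum_nonneg fun j _ => mul_nonneg (hh j).le (sq_nonneg _)
  have hΛ : 0 < ∏ j, lam j ^ (-(lam j)) :=
    Finset.prod_pos fun j _ => Real.rpow_pos_of_pos (hlam j) _
  have heps : ∀ ε : ℝ, 0 < ε → ‖A ⟨x, hxA⟩‖ ≤
      Real.sqrt (C.toReal * ∏ j, lam j ^ (-(lam j))) *
        ∏ j, (‖(B j) ⟨x, hxB j⟩‖ + ε) ^ lam j := by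
    intro ε hε
    have hpos : ∀ j, 0 < ‖(B j) ⟨x, hxB j⟩‖ + ε := fun j => by positivity
    have hQ : 0 < ∏ j, (‖(B j) ⟨x, hxB j⟩‖ + ε) ^ lam j :=
      Finset.prod_pos fun j _ => Real.rpow_pos_of_pos (hpos j) _
    have h1 := hmain (fun j => lam j / (‖(B j) ⟨x, hxB j⟩‖ + ε) ^ 2)
      fun j => div_pos (hlam j) (pow_pos (hpos j) 2)
    have h2 : ∑ j, lam j / (‖(B j) ⟨x, hxB j⟩‖ + ε) ^ 2 * ‖(B j) ⟨x, hxB j⟩‖ ^ 2 ≤ 1 := by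
      rw [← hlam1]
      refine Finset.sum_le_sum fun j _ => ?_
      rw [div_mul_eq_mul_div, div_le_iff₀ (pow_pos (hpos j) 2)]
      have := (hlam j).le
      gcongr
      linarith
    have h3 : ∏ j, (lam j / (‖(B j) ⟨x, hxB j⟩‖ + ε) ^ 2) ^ lam j =
        ((∏ j, lam j ^ (-(lam j))) * (∏ j, (‖(B j) ⟨x, hxB j⟩‖ + ε) ^ lam j) ^ 2)⁻¹ := by
      rw [← Finset.prod_pow, ← Finset.prod_mul_distrib, ← Finset.prod_inv_distrib]
      refine Finset.prod_congr rfl fun j _ => ?_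
      rw [Real.div_rpow (hlam j).le (sq_nonneg _), Real.rpow_neg (hlam j).le, mul_inv, inv_inv,
        div_eq_mul_inv, ← Real.rpow_natCast_mul (hpos j).le, mul_comm ((2 : ℕ) : ℝ),
        Real.rpow_mul_natCast (hpos j).le]
    rw [h3, inv_mul_le_iff₀ (by positivity)] at h1
    refine le_of_sq_le_sq ?_ (by positivity)
    rw [mul_pow, Real.sq_sqrt (by positivity)]
    calc _ ≤ _ := h1
      _ ≤ ((∏ j, lam j ^ (-(lam j))) * (∏ j, (‖(B j) ⟨x, hxB j⟩‖ + ε) ^ lam j) ^ 2) *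
          (C.toReal * 1) := by gcongr
      _ = _ := by ring
  have hlim : Filter.Tendsto (fun ε : ℝ => Real.sqrt (C.toReal * ∏ j, lam j ^ (-(lam j))) *
        ∏ j, (‖(B j) ⟨x, hxB j⟩‖ + ε) ^ lam j) (nhdsWithin 0 (Set.Ioi 0))
      (nhds (Real.sqrt (C.toReal * ∏ j, lam j ^ (-(lam j))) *
        ∏ j, ‖(B j) ⟨x, hxB j⟩‖ ^ lam j)) := by
    refine Filter.Tendsto.const_mul _ (tendsto_finsetProd _ fun j _ => ?_)
    refine Filter.Tendsto.rpow_const ?_ (Or.inr (hlam j).le)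
    refine tendsto_nhdsWithin_of_tendsto_nhds ?_
    simpa using (continuous_const_add ‖(B j) ⟨x, hxB j⟩‖).tendsto (0 : ℝ)
  exact ge_of_tendsto hlim (by filter_upwards [self_mem_nhdsWithin] with ε hε using heps ε hε)
end

section
/- Let m ∈ ℕ, real numbers r⁰ < r¹ < … < r^m, k ∈ ℝ, and λ_0,…,λ_m > 0 with λ_0 + … + λ_m = 1 and k + 1/2 ≤ λ_0 r⁰ + … + λ_m r^m. Then the constant 𝒞 := 2 · sup_{h ∈ (0,∞)^{m+1}} ( ∏_{j=0}^m h_j^{λ_j} · ∑_{j=1}^∞ j^{2k} / ( ∑_{l=0}^m h_l j^{2 r^l} ) ) is finite, and for every sequence c : ℤ → ℂ with c_0 = 0 and ∑_{n≠0} |n|^{2 r^j} |c_n|² < ∞ for each j, and every family of complex weights (w_n)_{n∈ℤ∖{0}} with |w_n| = |n|^k for all n, the series ∑_{n≠0} w_n c_n converges absolutely and | ∑_{n∈ℤ, n≠0} w_n c_n | ≤ sqrt( 𝒞 · ∏_{j=0}^m λ_j^{−λ_j} ) · ∏_{j=0}^m ( ∑_{n≠0} |n|^{2 r^j} |c_n|²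 )^{λ_j/2}. -/
open scoped ENNReal NNReal

/-- Telescoping majorant for the bump `q n^δ / (q + n^δ)^2 / n`. -/
lemma four_mul_div_le_telescope {q δ x : ℝ} (hq : 0 < q) (hδ : 0 < δ) (hx : 1 ≤ x) :
    4 * (q * x ^ δ) / (q + x ^ δ) ^ 2 / x ≤
      8 * 2 ^ δ / δ * ((x + 1) ^ δ / (q + (x + 1) ^ δ) - x ^ δ / (q + x ^ δ)) := by
  have hx0 : 0 < x := by linarith
  have hA : 0 < x ^ δ := Real.rpow_pos_of_pos hx0 δ
  have h2 : (1 : ℝ) ≤ 2 ^ δ := Real.one_le_rpow (by norm_num) hδ.le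
  have hgap : x ^ δ * (1 + δ / (2 * x)) ≤ (x + 1) ^ δ := by
    have hsplit : (x + 1) ^ δ = x ^ δ * (1 + 1 / x) ^ δ := by
      rw [← Real.mul_rpow hx0.le (by positivity)]
      congr 1
      field_simp
    have hlog : 1 / (2 * x) ≤ Real.log (1 + 1 / x) := by
      refine le_trans ?_ (Real.one_sub_inv_le_log_of_pos (by positivity))
      have : 1 - (1 + 1 / x)⁻¹ = 1 / (x + 1) := by
        field_simp
        ring
      rw [this]
      exact one_div_le_one_div_of_le (by positivity) (by linarith)
    rw [hsplit]
    gcongr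
    rw [Real.rpow_def_of_pos (by positivity)]
    refine le_trans ?_ (Real.add_one_le_exp _)
    have := mul_le_mul_of_nonneg_right hlog hδ.le
    have e : 1 / (2 * x) * δ = δ / (2 * x) := by ring
    linarith
  have hdouble : (x + 1) ^ δ ≤ 2 ^ δ * x ^ δ := by
    rw [← Real.mul_rpow (by norm_num) hx0.le]
    exact Real.rpow_le_rpow (by positivity) (by linarith) hδ.le
  generalize (x + 1) ^ δ = B at *
  generalize x ^ δ = A at *
  generalize (2 : ℝ) ^ δ = D at *
  have hB : 0 < B := lt_of_lt_of_le (by positivity) hgap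
  have hdiff : B / (q + B) - A / (q + A) = q * (B - A) / ((q + B) * (q + A)) := by
    field_simp
    ring
  have hlow : q * (A * δ / (2 * x)) / ((D * (q + A)) * (q + A)) ≤
      q * (B - A) / ((q + B) * (q + A)) := by
    have h1 : A * δ / (2 * x) ≤ B - A := by
      have : A * (1 + δ / (2 * x)) = A + A * δ / (2 * x) := by ring
      linarith
    have h3 : 0 ≤ B - A := le_trans (by positivity) h1
    have h4 : q + B ≤ D * (q + A) := by nlinarith
    gcongr
  rw [hdiff]
  refine le_trans (le_of_eq ?_) (mul_le_mul_of_nonneg_left hlow (by positivity))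
  field_simp
  ring

lemma le_four_mul_div_of_le_of_mul_le_one {E y : ℝ} (hy : 0 < y) (h1 : E ≤ y)
    (h2 : E * y ≤ 1) : E ≤ 4 * y / (1 + y) ^ 2 := by
  rw [le_div_iff₀ (by positivity)]
  rcases le_total y 1 with h | h
  · nlinarith [mul_le_mul_of_nonneg_right h1 (sq_nonneg (1 + y)), mul_nonneg hy.le (by nlinarith : 0 ≤ 4 - (1 + y) ^ 2)]
  · have hE : E * y ^ 2 ≤ y := by nlinarith
    rcases le_total E 0 with hE0 | hE0
    · nlinarith [mul_nonneg (neg_nonneg.2 hE0) (sq_nonneg (1 + y))]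
    · nlinarith [mul_nonneg hE0 (by nlinarith : 0 ≤ 4 * y ^ 2 - (1 + y) ^ 2)]

/-- A weighted geometric mean divided by the full sum is at most a power of a ratio. -/
lemma prod_rpow_div_sum_le {ι : Type*} [Fintype ι] {lam u : ι → ℝ} (hlam : ∀ j, 0 < lam j)
    (hlam1 : ∑ j, lam j = 1) (hu : ∀ j, 0 < u j) (i j : ι) :
    (∏ l, u l ^ lam l) / ∑ l, u l ≤ (u i / u j) ^ lam i := by
  classical
  have hle : ∀ l, u l ≤ ∑ l, u l := fun l =>
    Finset.single_le_sum (fun l _ => (hu l).le) (Finset.mem_univ l)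
  have hU : 0 < ∑ l, u l := (hu i).trans_le (hle i)
  have heq : (∏ l, u l ^ lam l) / ∑ l, u l = ∏ l, (u l / ∑ l, u l) ^ lam l := by
    simp_rw [Real.div_rpow (hu _).le hU.le, Finset.prod_div_distrib]
    rw [← Real.rpow_sum_of_pos hU, hlam1, Real.rpow_one]
  have hpos : ∀ l, 0 ≤ u l / ∑ l, u l := fun l => (div_pos (hu l) hU).le
  rw [heq, ← Finset.mul_prod_erase _ _ (Finset.mem_univ i)]
  refine (mul_le_of_le_one_right (Real.rpow_nonneg (hpos i) _) (Finset.prod_le_one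
    (fun l _ => Real.rpow_nonneg (hpos l) _) fun l _ =>
      Real.rpow_le_one (hpos l) ((div_le_one hU).2 (hle l)) (hlam l).le)).trans ?_
  exact Real.rpow_le_rpow (hpos i) (div_le_div_of_nonneg_left (hu i).le (hu j) (hle j))
    (hlam i).le

/-- Each term of the extremal series is dominated by a bump, uniformly in `h`. -/
lemma prod_rpow_mul_term_le {ι : Type*} [Fintype ι] {r lam h : ι → ℝ} {k μ : ℝ}
    (hlam : ∀ j, 0 < lam j) (hlam1 : ∑ j, lam j = 1) (hk : k + 1 / 2 ≤ ∑ j, lam j * r j)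
    (hh : ∀ j, 0 < h j) {i j : ι} (hμ : 0 < μ) (hi : μ ≤ lam i) (hj : μ ≤ lam j)
    {x : ℝ} (hx : 1 ≤ x) :
    (∏ l, h l ^ lam l) * (x ^ (2 * k) / ∑ l, h l * x ^ (2 * r l)) ≤
      4 * ((h i / h j) ^ μ * x ^ (2 * μ * (r j - r i))) /
        ((h i / h j) ^ μ + x ^ (2 * μ * (r j - r i))) ^ 2 / x := by
  have hx0 : 0 < x := by linarith
  have hu : ∀ l, 0 < h l * x ^ (2 * r l) := fun l =>
    mul_pos (hh l) (Real.rpow_pos_of_pos hx0 _)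
  have hU : 0 < ∑ l, h l * x ^ (2 * r l) := Finset.sum_pos (fun l _ => hu l) ⟨i, Finset.mem_univ i⟩
  have hP : ∏ l, (h l * x ^ (2 * r l)) ^ lam l =
      (∏ l, h l ^ lam l) * x ^ (2 * ∑ l, lam l * r l) := by
    simp_rw [Real.mul_rpow (hh _).le (Real.rpow_nonneg hx0.le _), Finset.prod_mul_distrib,
      ← Real.rpow_mul hx0.le]
    rw [← Real.rpow_sum_of_pos hx0, Finset.mul_sum]
    congr 2
    exact Finset.sum_congr rfl fun l _ => by ring
  have hPh : 0 < ∏ l, h l ^ lam l := Finset.prod_pos fun l _ => Real.rpow_pos_of_pos (hh l) _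
  set E := (∏ l, (h l * x ^ (2 * r l)) ^ lam l) / ∑ l, h l * x ^ (2 * r l) with hE
  have hpow : x ^ (2 * k) ≤ x ^ (2 * ∑ l, lam l * r l) / x := by
    rw [← Real.rpow_sub_one hx0.ne']
    exact Real.rpow_le_rpow_of_exponent_le hx (by linarith)
  have hstep : (∏ l, h l ^ lam l) * (x ^ (2 * k) / ∑ l, h l * x ^ (2 * r l)) ≤ E / x := by
    rw [hE, hP, mul_div_assoc, mul_div_assoc, div_right_comm]
    gcongr
  refine hstep.trans (div_le_div_of_nonneg_right ?_ hx0.le)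
  set R := h i * x ^ (2 * r i) / (h j * x ^ (2 * r j)) with hR
  have hR0 : 0 < R := div_pos (hu i) (hu j)
  have h1 : E ≤ R ^ lam i := prod_rpow_div_sum_le hlam hlam1 hu i j
  have h2 : E ≤ R⁻¹ ^ lam j := by
    rw [hR, inv_div]
    exact prod_rpow_div_sum_le hlam hlam1 hu j i
  have h0 : E ≤ 1 := by
    refine (prod_rpow_div_sum_le hlam hlam1 hu i i).trans ?_
    rw [div_self (hu i).ne', Real.one_rpow]
  have hEy : E ≤ R ^ μ := by
    rcases le_total R 1 with hR1 | hR1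
    · exact h1.trans (Real.rpow_le_rpow_of_exponent_ge hR0 hR1 hi)
    · exact h0.trans (Real.one_le_rpow hR1 hμ.le)
  have hEy' : E ≤ (R ^ μ)⁻¹ := by
    rw [← Real.inv_rpow hR0.le]
    rcases le_total R 1 with hR1 | hR1
    · exact h0.trans (Real.one_le_rpow ((one_le_inv₀ hR0).2 hR1) hμ.le)
    · exact h2.trans (Real.rpow_le_rpow_of_exponent_ge (inv_pos.2 hR0)
        (inv_le_one_of_one_le₀ hR1) hj)
  have hy : 0 < R ^ μ := Real.rpow_pos_of_pos hR0 _
  have hA : 0 < x ^ (2 * μ * (r j - r i)) := Real.rpow_pos_of_pos hx0 _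
  have hyq : R ^ μ = (h i / h j) ^ μ / x ^ (2 * μ * (r j - r i)) := by
    have : R = (h i / h j) / x ^ (2 * (r j - r i)) := by
      rw [hR, mul_sub, Real.rpow_sub hx0]
      have := hh j
      field_simp
    rw [this, Real.div_rpow (div_pos (hh i) (hh j)).le (Real.rpow_nonneg hx0.le _),
      ← Real.rpow_mul hx0.le]
    congr 2
    ring
  refine (le_four_mul_div_of_le_of_mul_le_one hy hEy
    ((le_div_iff₀ hy).1 (by rwa [one_div]))).trans (le_of_eq ?_)
  have hq : 0 < (h i / h j) ^ μ := Real.rpow_pos_of_pos (div_pos (hh i) (hh j)) _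
  rw [hyq]
  field_simp
  ring

lemma iSup_prod_mul_tsum_ne_top {ι : Type*} [Fintype ι] {r lam : ι → ℝ} {k : ℝ}
    (hlam : ∀ j, 0 < lam j) (hlam1 : ∑ j, lam j = 1) (hk : k + 1 / 2 ≤ ∑ j, lam j * r j)
    {i j : ι} (hij : r i < r j) :
    (⨆ (h : ι → ℝ) (_ : ∀ j, 0 < h j), (∏ j, ENNReal.ofReal (h j ^ lam j)) *
      ∑' n : ℕ+, ENNReal.ofReal ((n : ℝ) ^ (2 * k) / ∑ l, h l * (n : ℝ) ^ (2 * r l))) ≠ ⊤ := by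
  set μ := min (lam i) (lam j)
  have hμ : 0 < μ := lt_min (hlam i) (hlam j)
  set δ := 2 * μ * (r j - r i)
  have hδ : 0 < δ := mul_pos (by linarith) (by linarith)
  refine ne_top_of_le_ne_top (ENNReal.ofReal_ne_top (r := 8 * 2 ^ δ / δ)) ?_
  refine iSup₂_le fun h hh => ?_
  have hpow : ∀ j, 0 ≤ h j ^ lam j := fun j => Real.rpow_nonneg (hh j).le _
  have hq : 0 < (h i / h j) ^ μ := Real.rpow_pos_of_pos (div_pos (hh i) (hh j)) _
  rw [← ENNReal.ofReal_prod_of_nonneg fun j _ => hpow j, ← ENNReal.tsum_mul_left,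
    tsum_pnat_eq_tsum_succ (f := fun n : ℕ => ENNReal.ofReal (∏ j, h j ^ lam j) *
      ENNReal.ofReal ((n : ℝ) ^ (2 * k) / ∑ l, h l * (n : ℝ) ^ (2 * r l)))]
  simp_rw [← ENNReal.ofReal_mul (Finset.prod_nonneg fun j _ => hpow j)]
  refine ENNReal.tsum_le_of_sum_range_le fun N => ?_
  have hsum : ∀ n : ℕ, 0 ≤ ∑ l, h l * (n : ℝ) ^ (2 * r l) :=
    fun n => Finset.sum_nonneg fun l _ =>
      mul_nonneg (hh l).le (Real.rpow_nonneg n.cast_nonneg _)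
  rw [← ENNReal.ofReal_sum_of_nonneg fun n _ => mul_nonneg (Finset.prod_nonneg fun j _ => hpow j)
    (div_nonneg (Real.rpow_nonneg (Nat.cast_nonneg _) _) (hsum _))]
  refine ENNReal.ofReal_le_ofReal ?_
  let F : ℕ → ℝ := fun n => ((n + 1 : ℕ) : ℝ) ^ δ / ((h i / h j) ^ μ + ((n + 1 : ℕ) : ℝ) ^ δ)
  have hF0 : 0 ≤ F 0 := by positivity
  have hF1 : F N ≤ 1 := div_le_one_of_le₀ (by linarith) (by positivity)
  calc ∑ n ∈ Finset.range N, _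
      ≤ ∑ n ∈ Finset.range N, 8 * 2 ^ δ / δ * (F (n + 1) - F n) := by
        refine Finset.sum_le_sum fun n _ => ?_
        have hn : (1 : ℝ) ≤ ((n + 1 : ℕ) : ℝ) := by exact_mod_cast Nat.le_add_left 1 n
        refine (prod_rpow_mul_term_le hlam hlam1 hk hh hμ (min_le_left _ _) (min_le_right _ _)
          hn).trans ((four_mul_div_le_telescope hq hδ hn).trans (le_of_eq ?_))
        simp [F]
    _ = 8 * 2 ^ δ / δ * (F N - F 0) := by rw [← Finset.mul_sum, Finset.sum_range_sub]
    _ ≤ 8 * 2 ^ δ / δ := mul_le_of_le_one_right (by positivity) (by linarith)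

/-- A finite sum of an even nonnegative function over nonzero integers is at most twice the sum
over the positive integers. -/
lemma sum_abs_le_two_mul_toReal_tsum {f : ℝ → ℝ} (hf : ∀ x, 0 ≤ x → 0 ≤ f x)
    (hS : ∑' n : ℕ+, ENNReal.ofReal (f n) ≠ ⊤) (s : Finset ℤ) :
    ∑ n ∈ s, (if n = 0 then 0 else f |(n : ℝ)|) ≤
      2 * (∑' n : ℕ+, ENNReal.ofReal (f n)).toReal := by
  set A : ℤ → ℝ := fun n => if n = 0 then 0 else f |(n : ℝ)| with hA
  have hApos : ∀ n : ℕ+, A n = f n := fun n => by simp [hA]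
  have hAneg : ∀ n, A (-n) = A n := fun n => by simp [hA]
  have hA0 : ∀ n, 0 ≤ A n := fun n => by
    simp only [hA]
    split_ifs
    exacts [le_rfl, hf _ (abs_nonneg _)]
  have hfn : ∀ n : ℕ+, 0 ≤ f n := fun n => hf _ (Nat.cast_nonneg _)
  have hreal : ∀ n : ℕ+, (ENNReal.ofReal (f n)).toReal = A n := fun n => by
    rw [ENNReal.toReal_ofReal (hfn n), hApos]
  have hsumP : Summable fun n : ℕ+ => A n :=
    (ENNReal.summable_toReal hS).congr fun n => hreal n
  have hsumN : Summable fun n : ℕ => A n :=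
    (summable_pnat_iff_summable_nat (f := fun n : ℕ => A n)).1 hsumP
  have hsumZ : Summable A := Summable.of_nat_of_neg hsumN (by simpa only [hAneg] using hsumN)
  refine (hsumZ.sum_le_tsum s fun n _ => hA0 n).trans (le_of_eq ?_)
  rw [tsum_int_eq_zero_add_two_mul_tsum_pnat hAneg hsumZ,
    ENNReal.tsum_toReal_eq fun _ => ENNReal.ofReal_ne_top, tsum_congr hreal]
  simp [hA]

/-- Cauchy–Schwarz against the weight `∑ l, h l * |n| ^ (2 * r l)`. -/
lemma sq_sum_norm_mul_le {ι : Type*} [Fintype ι] [Nonempty ι] {r h : ι → ℝ} {k : ℝ}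
    (hh : ∀ j, 0 < h j)
    (hS : ∑' n : ℕ+, ENNReal.ofReal ((n : ℝ) ^ (2 * k) /
      ∑ l, h l * (n : ℝ) ^ (2 * r l)) ≠ ⊤) {c w : ℤ → ℂ} (hc : c 0 = 0)
    (hsum : ∀ j, Summable fun n : ℤ => |(n : ℝ)| ^ (2 * r j) * ‖c n‖ ^ 2)
    (hw : ∀ n : ℤ, n ≠ 0 → ‖w n‖ = |(n : ℝ)| ^ k) (s : Finset ℤ) :
    (∑ n ∈ s, ‖w n * c n‖) ^ 2 ≤
      2 * (∑' n : ℕ+, ENNReal.ofReal ((n : ℝ) ^ (2 * k) /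
        ∑ l, h l * (n : ℝ) ^ (2 * r l))).toReal *
      ∑ l, h l * ∑' n : ℤ, |(n : ℝ)| ^ (2 * r l) * ‖c n‖ ^ 2 := by
  let f : ℝ → ℝ := fun x => x ^ (2 * k) / ∑ l, h l * x ^ (2 * r l)
  have hD : ∀ x : ℝ, 0 ≤ x → 0 ≤ ∑ l, h l * x ^ (2 * r l) := fun x hx =>
    Finset.sum_nonneg fun l _ => mul_nonneg (hh l).le (Real.rpow_nonneg hx _)
  have hf : ∀ x, 0 ≤ x → 0 ≤ f x := fun x hx => div_nonneg (Real.rpow_nonneg hx _) (hD x hx)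
  have hG0 : ∀ n : ℤ, 0 ≤ ∑ l, h l * (|(n : ℝ)| ^ (2 * r l) * ‖c n‖ ^ 2) := fun n =>
    Finset.sum_nonneg fun l _ => mul_nonneg (hh l).le
      (mul_nonneg (Real.rpow_nonneg (abs_nonneg _) _) (sq_nonneg _))
  have hG : ∑ n ∈ s, ∑ l, h l * (|(n : ℝ)| ^ (2 * r l) * ‖c n‖ ^ 2) ≤
      ∑ l, h l * ∑' n : ℤ, |(n : ℝ)| ^ (2 * r l) * ‖c n‖ ^ 2 := by
    rw [Finset.sum_comm]
    refine Finset.sum_le_sum fun l _ => ?_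
    rw [← Finset.mul_sum]
    exact mul_le_mul_of_nonneg_left ((hsum l).sum_le_tsum s fun n _ =>
      mul_nonneg (Real.rpow_nonneg (abs_nonneg _) _) (sq_nonneg _)) (hh l).le
  refine (Finset.sum_sq_le_sum_mul_sum_of_sq_le_mul s
    (f := fun n : ℤ => if n = 0 then 0 else f |(n : ℝ)|) (fun n _ => ?_) (fun n _ => hG0 n)
    fun n _ => le_of_eq ?_).trans (mul_le_mul (sum_abs_le_two_mul_toReal_tsum hf hS s) hG
      (Finset.sum_nonneg fun n _ => hG0 n) (by positivity))
  · split_ifs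
    exacts [le_rfl, hf _ (abs_nonneg _)]
  · rcases eq_or_ne n 0 with rfl | hn
    · simp [hc]
    · have hx : 0 < |(n : ℝ)| := abs_pos.2 (Int.cast_ne_zero.2 hn)
      have hDpos : 0 < ∑ l, h l * |(n : ℝ)| ^ (2 * r l) :=
        Finset.sum_pos (fun l _ => mul_pos (hh l) (Real.rpow_pos_of_pos hx _))
          Finset.univ_nonempty
      simp_rw [if_neg hn, f, ← mul_assoc, ← Finset.sum_mul]
      rw [norm_mul, hw n hn, mul_pow, ← Real.rpow_natCast (|(n : ℝ)| ^ k), ← Real.rpow_mul hx.le,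
        ← mul_assoc, div_mul_cancel₀ _ hDpos.ne']
      congr 2
      push_cast
      ring

/-- Optimising the Cauchy–Schwarz bound over `h`. -/
lemma sum_norm_mul_le_sqrt_mul_prod {ι : Type*} [Fintype ι] [Nonempty ι] {r lam : ι → ℝ} {k : ℝ}
    (hlam : ∀ j, 0 < lam j) (hlam1 : ∑ j, lam j = 1) {K : ℝ≥0∞} (hK : K ≠ ⊤)
    (hbound : ∀ h : ι → ℝ, (∀ j, 0 < h j) → (∏ j, ENNReal.ofReal (h j ^ lam j)) *
      ∑' n : ℕ+, ENNReal.ofReal ((n : ℝ) ^ (2 * k) / ∑ l, h l * (n : ℝ) ^ (2 * r l)) ≤ K)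
    {c w : ℤ → ℂ} (hc : c 0 = 0)
    (hsum : ∀ j, Summable fun n : ℤ => |(n : ℝ)| ^ (2 * r j) * ‖c n‖ ^ 2)
    (hw : ∀ n : ℤ, n ≠ 0 → ‖w n‖ = |(n : ℝ)| ^ k) (s : Finset ℤ) :
    ∑ n ∈ s, ‖w n * c n‖ ≤ Real.sqrt ((2 * K).toReal * ∏ j, lam j ^ (-(lam j))) *
      ∏ j, (∑' n : ℤ, |(n : ℝ)| ^ (2 * r j) * ‖c n‖ ^ 2) ^ (lam j / 2) := by
  have hterm : ∀ j, ∀ n : ℤ, 0 ≤ |(n : ℝ)| ^ (2 * r j) * ‖c n‖ ^ 2 := fun j n =>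
    mul_nonneg (Real.rpow_nonneg (abs_nonneg _) _) (sq_nonneg _)
  by_cases hc0 : ∀ n, c n = 0
  · simp only [hc0, mul_zero, norm_zero, Finset.sum_const_zero]
    exact mul_nonneg (Real.sqrt_nonneg _) (Finset.prod_nonneg fun j _ =>
      Real.rpow_nonneg (tsum_nonneg fun n => by simp) _)
  push Not at hc0
  obtain ⟨p, hp⟩ := hc0
  have hp0 : p ≠ 0 := fun h => hp (h ▸ hc)
  have hN : ∀ j, 0 < ∑' n : ℤ, |(n : ℝ)| ^ (2 * r j) * ‖c n‖ ^ 2 := fun j =>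
    (hsum j).tsum_pos (hterm j) p (mul_pos
      (Real.rpow_pos_of_pos (abs_pos.2 (Int.cast_ne_zero.2 hp0)) _) (pow_pos (norm_pos_iff.2 hp) 2))
  set N : ι → ℝ := fun j => ∑' n : ℤ, |(n : ℝ)| ^ (2 * r j) * ‖c n‖ ^ 2
  have hh : ∀ j, 0 < lam j / N j := fun j => div_pos (hlam j) (hN j)
  have hP0 : 0 < ∏ j, (lam j / N j) ^ lam j :=
    Finset.prod_pos fun j _ => Real.rpow_pos_of_pos (hh j) _
  have hb := hbound (fun j => lam j / N j) hh
  rw [← ENNReal.ofReal_prod_of_nonneg fun j _ => Real.rpow_nonneg (hh j).le _] at hb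
  have hS : ∑' n : ℕ+, ENNReal.ofReal ((n : ℝ) ^ (2 * k) /
      ∑ l, lam l / N l * (n : ℝ) ^ (2 * r l)) ≠ ⊤ := by
    intro htop
    rw [htop, ENNReal.mul_top (ENNReal.ofReal_pos.2 hP0).ne'] at hb
    exact hK (top_le_iff.1 hb)
  have hb' := ENNReal.toReal_mono hK hb
  rw [ENNReal.toReal_mul, ENNReal.toReal_ofReal hP0.le] at hb'
  have hCS := sq_sum_norm_mul_le hh hS hc hsum hw s
  have hone : ∑ l, lam l / N l * N l = 1 := by
    rw [← hlam1]
    exact Finset.sum_congr rfl fun l _ => div_mul_cancel₀ _ (hN l).ne'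
  rw [hone, mul_one] at hCS
  have hprod : (∏ j, lam j ^ (-(lam j))) * (∏ j, N j ^ (lam j / 2)) ^ 2 =
      (∏ j, (lam j / N j) ^ lam j)⁻¹ := by
    rw [← Finset.prod_pow, ← Finset.prod_mul_distrib, ← Finset.prod_inv_distrib]
    refine Finset.prod_congr rfl fun j _ => ?_
    rw [← Real.rpow_natCast, ← Real.rpow_mul (hN j).le, Real.rpow_neg (hlam j).le,
      Real.div_rpow (hlam j).le (hN j).le, inv_div,
      Nat.cast_ofNat, div_mul_cancel₀ _ (two_ne_zero' ℝ), div_eq_inv_mul]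
  have hM : 0 ≤ ∏ j, N j ^ (lam j / 2) :=
    Finset.prod_nonneg fun j _ => Real.rpow_nonneg (hN j).le _
  rw [← Real.sqrt_sq hM, ← Real.sqrt_mul (mul_nonneg ENNReal.toReal_nonneg
    (Finset.prod_nonneg fun j _ => Real.rpow_nonneg (hlam j).le _)), mul_assoc, hprod]
  refine Real.le_sqrt_of_sq_le (hCS.trans ?_)
  rw [ENNReal.toReal_mul, ENNReal.toReal_ofNat, mul_assoc]
  refine mul_le_mul_of_nonneg_left ?_ zero_le_two
  rwa [← div_eq_mul_inv, le_div_iff₀ hP0, mul_comm]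

/-- Taikov-type multiplicative inequality for periodic functions, in
Fourier-coefficient form.  If `r⁰ < … < r^m`, `λ_j > 0` sum to `1` and
`k + 1/2 ≤ ∑_j λ_j r^j`, then the constant
`𝒞 = 2 sup_{h>0} ∏_j h_j^{λ_j} ∑_{n=1}^∞ n^{2k}/(∑_l h_l n^{2r^l})` is finite, and for every
`c : ℤ → ℂ` with `c 0 = 0` and `∑_{n≠0} |n|^{2r^j}|c_n|² < ∞` for each `j`, and every family
of weights `w` with `|w_n| = |n|^k` (`n ≠ 0`), the series `∑_{n≠0} w_n c_n` converges
absolutely and `|∑_{n≠0} w_n c_n| ≤ sqrt(𝒞 ∏_j λ_j^{-λ_j}) ∏_j (∑_{n≠0} |n|^{2r^j}|c_n|²)^{λ_j/2}`. -/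
theorem statement14
    (m : ℕ) (hm : 0 < m) (r : Fin (m + 1) → ℝ) (hr : StrictMono r) (k : ℝ)
    (lam : Fin (m + 1) → ℝ) (hlam : ∀ j, 0 < lam j) (hlam1 : ∑ j, lam j = 1)
    (hk : k + 1 / 2 ≤ ∑ j, lam j * r j) :
    (2 * ⨆ (h : Fin (m + 1) → ℝ) (_ : ∀ j, 0 < h j),
        (∏ j, ENNReal.ofReal (h j ^ lam j)) *
          ∑' n : ℕ+, ENNReal.ofReal ((n : ℝ) ^ (2 * k) /
            ∑ l, h l * (n : ℝ) ^ (2 * r l))) ≠ ⊤ ∧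
    ∀ (c : ℤ → ℂ), c 0 = 0 →
      (∀ j, Summable fun n : ℤ => |(n : ℝ)| ^ (2 * r j) * ‖c n‖ ^ 2) →
      ∀ w : ℤ → ℂ, (∀ n : ℤ, n ≠ 0 → ‖w n‖ = |(n : ℝ)| ^ k) →
        (Summable fun n : ℤ => ‖w n * c n‖) ∧
        ‖∑' n : ℤ, w n * c n‖ ≤
          Real.sqrt ((2 * ⨆ (h : Fin (m + 1) → ℝ) (_ : ∀ j, 0 < h j),
              (∏ j, ENNReal.ofReal (h j ^ lam j)) *
                ∑' n : ℕ+, ENNReal.ofReal ((n : ℝ) ^ (2 * k) /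
                  ∑ l, h l * (n : ℝ) ^ (2 * r l))).toReal *
            ∏ j, lam j ^ (-(lam j))) *
          ∏ j, (∑' n : ℤ, |(n : ℝ)| ^ (2 * r j) * ‖c n‖ ^ 2) ^ (lam j / 2) := by
  have hfin := iSup_prod_mul_tsum_ne_top hlam hlam1 hk (hr (show 0 < Fin.last m from hm))
  refine ⟨ENNReal.mul_ne_top ENNReal.ofNat_ne_top hfin, fun c hc hsum w hw => ?_⟩
  have hle := sum_norm_mul_le_sqrt_mul_prod hlam hlam1 hfin
    (fun h hh => le_iSup₂_of_le h hh le_rfl) hc hsum hw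
  have hs : Summable fun n : ℤ => ‖w n * c n‖ := summable_of_sum_le (fun _ => norm_nonneg _) hle
  exact ⟨hs, (norm_tsum_le_tsum_norm hs).trans (hs.tsum_le_of_sum_le hle)⟩
end

section
/- Let d ∈ ℕ, m ∈ ℤ≥0, vectors k, r⁰,…,r^m ∈ ℝ^d, and λ_0,…,λ_m > 0 with λ_0 + … + λ_m = 1 and k = λ_0 r⁰ + … + λ_m r^m (so k lies in the convex hull 𝒮(r⁰,…,r^m)). Then for every measurable function y : ℝ^d → ℂ such that ∫_{ℝ^d} ∏_{i=1}^d |t_i|^{2 r^j_i} |y(t)|² dt < ∞ for each j = 0,…,m, one has ( ∫_{ℝ^d} ∏_{i=1}^d |t_i|^{2 k_i} |y(t)|² dt )^{1/2} ≤ ∏_{j=0}^m ( ∫_{ℝ^d} ∏_{i=1}^d |t_i|^{2 r^j_i} |y(t)|² dt )^{λ_j/2}, and the constant 1 is sharp: the supremum of the left-hand side divided by the right-hand side over all admissible y with nonzero right-hand side equals 1. -/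
open MeasureTheory

/-- Hölder's inequality for a weighted geometric mean of finitely many nonnegative integrable
functions. -/
theorem integrable_prod_rpow_and_integral_le {α ι : Type*} [MeasurableSpace α] {μ : Measure α}
    [Fintype ι] {f : ι → α → ℝ} {p : ι → ℝ} (hp : ∀ j, 0 < p j) (hp1 : ∑ j, p j = 1)
    (hf0 : ∀ j x, 0 ≤ f j x) (hf : ∀ j, Integrable (f j) μ) :
    Integrable (fun x => ∏ j, f j x ^ p j) μ ∧
      ∫ x, ∏ j, f j x ^ p j ∂μ ≤ ∏ j, (∫ x, f j x ∂μ) ^ p j := by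
  have hmeas : AEStronglyMeasurable (fun x => ∏ j, f j x ^ p j) μ := by
    have hm : AEMeasurable (fun x => ∏ j, f j x ^ p j) μ :=
      Finset.aemeasurable_fun_prod _ fun j _ => (hf j).aemeasurable.pow_const _
    exact hm.aestronglyMeasurable
  have hnn : ∀ x, 0 ≤ ∏ j, f j x ^ p j := fun x =>
    Finset.prod_nonneg fun j _ => Real.rpow_nonneg (hf0 j x) _
  have hint : Integrable (fun x => ∏ j, f j x ^ p j) μ := by
    refine (integrable_finsetSum Finset.univ fun j _ => (hf j).const_mul (p j)).mono' hmeas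
      (.of_forall fun x => ?_)
    rw [Real.norm_of_nonneg (hnn x)]
    exact Real.geom_mean_le_arith_mean_weighted _ _ _ (fun j _ => (hp j).le) hp1
      fun j _ => hf0 j x
  refine ⟨hint, ?_⟩
  have key := ENNReal.lintegral_prod_norm_pow_le (μ := μ) Finset.univ
    (f := fun j x => ENNReal.ofReal (f j x))
    (fun j _ => (hf j).aemeasurable.ennreal_ofReal) hp1 (fun j _ => (hp j).le)
  have hR : 0 ≤ ∏ j, (∫ x, f j x ∂μ) ^ p j :=
    Finset.prod_nonneg fun j _ => Real.rpow_nonneg (integral_nonneg (hf0 j)) _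
  rw [← ENNReal.ofReal_le_ofReal_iff hR, ofReal_integral_eq_lintegral_ofReal hint
    (.of_forall hnn), ENNReal.ofReal_prod_of_nonneg
      fun j _ => Real.rpow_nonneg (integral_nonneg (hf0 j)) _]
  convert key using 1
  · refine lintegral_congr fun x => ?_
    rw [ENNReal.ofReal_prod_of_nonneg fun j _ => Real.rpow_nonneg (hf0 j x) _]
    exact Finset.prod_congr rfl fun j _ =>
      (ENNReal.ofReal_rpow_of_nonneg (hf0 j x) (hp j).le).symm
  · refine Finset.prod_congr rfl fun j _ => ?_
    rw [← ENNReal.ofReal_rpow_of_nonneg (integral_nonneg (hf0 j)) (hp j).le,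
      ofReal_integral_eq_lintegral_ofReal (hf j) (.of_forall (hf0 j))]

/-- Almost every point of `ℝ^d` has only nonzero coordinates. -/
theorem ae_forall_apply_ne_zero {ι : Type*} [Fintype ι] :
    ∀ᵐ t : ι → ℝ, ∀ i, t i ≠ 0 :=
  ae_all_iff.mpr fun i => Measure.ae_eval_ne (fun _ => volume) i 0

/-- A monomial weight whose exponent is a convex combination is the weighted geometric mean of the
corresponding weights. -/
theorem prod_weight_mul_rpow {ι κ : Type*} [Fintype ι] [Fintype κ] {k : ι → ℝ} {r : κ → ι → ℝ}
    {p : κ → ℝ} (hp1 : ∑ j, p j = 1) (hk : ∀ i, k i = ∑ j, p j * r j i)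
    {t : ι → ℝ} (ht : ∀ i, t i ≠ 0) {a : ℝ} (ha : 0 ≤ a) (hp : ∀ j, 0 < p j) :
    ∏ j, ((∏ i, |t i| ^ (2 * r j i)) * a) ^ p j = (∏ i, |t i| ^ (2 * k i)) * a := by
  have hsplit : ∀ j, ((∏ i, |t i| ^ (2 * r j i)) * a) ^ p j =
      (∏ i, |t i| ^ (2 * (p j * r j i))) * a ^ p j := fun j => by
    rw [Real.mul_rpow (Finset.prod_nonneg fun i _ => by positivity) ha,
      ← Real.finsetProd_rpow _ _ fun i _ => by positivity]
    congr 1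
    refine Finset.prod_congr rfl fun i _ => ?_
    rw [← Real.rpow_mul (abs_nonneg _)]
    ring_nf
  simp_rw [hsplit]
  rw [Finset.prod_mul_distrib, Finset.prod_comm,
    ← Real.rpow_sum_of_nonneg ha fun j _ => (hp j).le, hp1, Real.rpow_one]
  congr 1
  refine Finset.prod_congr rfl fun i _ => ?_
  rw [← Real.rpow_sum_of_pos (abs_pos.mpr (ht i)), hk, Finset.mul_sum]

/-- The multiplicative inequality between weighted `L²`-norms. -/
theorem integrable_weight_and_sqrt_integral_le {ι κ : Type*} [Fintype ι] [Fintype κ]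
    {k : ι → ℝ} {r : κ → ι → ℝ} {p : κ → ℝ} (hp : ∀ j, 0 < p j) (hp1 : ∑ j, p j = 1)
    (hk : ∀ i, k i = ∑ j, p j * r j i) (y : (ι → ℝ) → ℂ)
    (hy : ∀ j, Integrable (fun t : ι → ℝ => (∏ i, |t i| ^ (2 * r j i)) * ‖y t‖ ^ 2)) :
    Integrable (fun t : ι → ℝ => (∏ i, |t i| ^ (2 * k i)) * ‖y t‖ ^ 2) ∧
      Real.sqrt (∫ t : ι → ℝ, (∏ i, |t i| ^ (2 * k i)) * ‖y t‖ ^ 2) ≤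
        ∏ j, (∫ t : ι → ℝ, (∏ i, |t i| ^ (2 * r j i)) * ‖y t‖ ^ 2) ^ (p j / 2) := by
  have hnn : ∀ j (t : ι → ℝ), 0 ≤ (∏ i, |t i| ^ (2 * r j i)) * ‖y t‖ ^ 2 := fun j t =>
    mul_nonneg (Finset.prod_nonneg fun i _ => by positivity) (by positivity)
  obtain ⟨hint, hle⟩ := integrable_prod_rpow_and_integral_le hp hp1 hnn hy
  have hae : (fun t : ι → ℝ => ∏ j, ((∏ i, |t i| ^ (2 * r j i)) * ‖y t‖ ^ 2) ^ p j) =ᵐ[volume]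
      fun t => (∏ i, |t i| ^ (2 * k i)) * ‖y t‖ ^ 2 := by
    filter_upwards [ae_forall_apply_ne_zero] with t ht
    exact prod_weight_mul_rpow hp1 hk ht (by positivity) hp
  refine ⟨hint.congr hae, ?_⟩
  rw [← integral_congr_ae hae]
  refine (Real.sqrt_le_sqrt hle).trans_eq ?_
  rw [Real.sqrt_eq_rpow, ← Real.finsetProd_rpow _ _ fun j _ =>
    Real.rpow_nonneg (integral_nonneg (hnn j)) _]
  refine Finset.prod_congr rfl fun j _ => ?_
  rw [← Real.rpow_mul (integral_nonneg (hnn j))]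
  ring_nf

/-- Monomial weights are continuous at the point `(1, …, 1)`, where they equal `1`. -/
theorem tendsto_prod_abs_rpow_one {ι : Type*} [Fintype ι] (s : ι → ℝ) :
    Filter.Tendsto (fun t : ι → ℝ => ∏ i, |t i| ^ (2 * s i)) (nhds 1) (nhds 1) := by
  have h : ContinuousAt (fun t : ι → ℝ => ∏ i, |t i| ^ (2 * s i)) 1 := by
    refine tendsto_finsetProd _ fun i _ => ?_
    exact ((continuous_apply i).abs.continuousAt).rpow_const (Or.inl (by simp))
  simpa [ContinuousAt] using h

/-- Functions concentrated near `(1, …, 1)` make the ratio of the two sides at least `q`, for any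
`q < 1`. -/
theorem exists_le_ratio {ι κ : Type*} [Fintype ι] [Fintype κ]
    (k : ι → ℝ) (r : κ → ι → ℝ) {p : κ → ℝ} (hp : ∀ j, 0 < p j) (hp1 : ∑ j, p j = 1)
    {q : ℝ} (hq0 : 0 < q) (hq1 : q < 1) :
    ∃ y : (ι → ℝ) → ℂ, Measurable y ∧
      (∀ j, Integrable (fun t : ι → ℝ => (∏ i, |t i| ^ (2 * r j i)) * ‖y t‖ ^ 2)) ∧
      (∏ j, (∫ t : ι → ℝ, (∏ i, |t i| ^ (2 * r j i)) * ‖y t‖ ^ 2) ^ (p j / 2)) ≠ 0 ∧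
      q ≤ Real.sqrt (∫ t : ι → ℝ, (∏ i, |t i| ^ (2 * k i)) * ‖y t‖ ^ 2) /
        ∏ j, (∫ t : ι → ℝ, (∏ i, |t i| ^ (2 * r j i)) * ‖y t‖ ^ 2) ^ (p j / 2) := by
  have hqinv : 1 < q⁻¹ := (one_lt_inv₀ hq0).mpr hq1
  have hnear : ∀ s : ι → ℝ, ∀ᶠ t in nhds (1 : ι → ℝ),
      ∏ i, |t i| ^ (2 * s i) ∈ Set.Ioo q q⁻¹ := fun s =>
    tendsto_prod_abs_rpow_one s (Ioo_mem_nhds hq1 hqinv)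
  obtain ⟨ε, hε, hball⟩ := Metric.eventually_nhds_iff_ball.mp
    ((hnear k).and (Filter.eventually_all.mpr fun j => hnear (r j)))
  set B := Metric.ball (1 : ι → ℝ) ε
  have hBm : MeasurableSet B := measurableSet_ball
  have hBfin : volume B ≠ ⊤ := measure_ball_lt_top.ne
  have hV : 0 < volume.real B := ENNReal.toReal_pos (Metric.measure_ball_pos _ _ hε).ne' hBfin
  have hy : ∀ s : ι → ℝ, (fun t : ι → ℝ => (∏ i, |t i| ^ (2 * s i)) *
      ‖B.indicator (fun _ => (1 : ℂ)) t‖ ^ 2) =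
        B.indicator fun t => ∏ i, |t i| ^ (2 * s i) := fun s => by
    ext t
    by_cases ht : t ∈ B <;> simp [ht]
  have hbound : ∀ s : ι → ℝ, (∀ t ∈ B, ∏ i, |t i| ^ (2 * s i) ∈ Set.Ioo q q⁻¹) →
      IntegrableOn (fun t : ι → ℝ => ∏ i, |t i| ^ (2 * s i)) B ∧
      q * volume.real B ≤ ∫ t in B, ∏ i, |t i| ^ (2 * s i) ∧
      ∫ t in B, ∏ i, |t i| ^ (2 * s i) ≤ q⁻¹ * volume.real B := fun s hs => by
    have hc : ∀ c : ℝ, IntegrableOn (fun _ : ι → ℝ => c) B := fun c =>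
      integrableOn_const hBfin
    have hi : IntegrableOn (fun t : ι → ℝ => ∏ i, |t i| ^ (2 * s i)) B := by
      refine (hc q⁻¹).mono' (by fun_prop : Measurable _).aestronglyMeasurable
        ((ae_restrict_iff' hBm).mpr (.of_forall fun t ht => ?_))
      rw [Real.norm_of_nonneg (hq0.le.trans (hs t ht).1.le)]
      exact (hs t ht).2.le
    refine ⟨hi, ?_, ?_⟩
    · simpa [mul_comm] using setIntegral_mono_on (hc q) hi hBm fun t ht => (hs t ht).1.le
    · simpa [mul_comm] using setIntegral_mono_on hi (hc q⁻¹) hBm fun t ht => (hs t ht).2.le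
  have hk := hbound k fun t ht => (hball t ht).1
  have hr := fun j => hbound (r j) fun t ht => (hball t ht).2 j
  have hpos : ∀ j, 0 < ∫ t in B, ∏ i, |t i| ^ (2 * r j i) := fun j =>
    (mul_pos hq0 hV).trans_le (hr j).2.1
  refine ⟨B.indicator fun _ => 1, measurable_const.indicator hBm, ?_⟩
  simp_rw [hy, integral_indicator hBm]
  have hden : 0 < ∏ j, (∫ t in B, ∏ i, |t i| ^ (2 * r j i)) ^ (p j / 2) :=
    Finset.prod_pos fun j _ => Real.rpow_pos_of_pos (hpos j) _
  refine ⟨fun j => (integrable_indicator_iff hBm).mpr (hr j).1, hden.ne', ?_⟩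
  rw [le_div_iff₀ hden]
  calc q * ∏ j, (∫ t in B, ∏ i, |t i| ^ (2 * r j i)) ^ (p j / 2)
      ≤ q * ∏ j, (q⁻¹ * volume.real B) ^ (p j / 2) := by
        refine mul_le_mul_of_nonneg_left (Finset.prod_le_prod (fun j _ => ?_) fun j _ => ?_) hq0.le
        · exact Real.rpow_nonneg (hpos j).le _
        · exact Real.rpow_le_rpow (hpos j).le (hr j).2.2 (half_pos (hp j)).le
    _ = q * Real.sqrt (q⁻¹ * volume.real B) := by
        rw [← Real.rpow_sum_of_pos (by positivity), ← Finset.sum_div, hp1, Real.sqrt_eq_rpow]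
    _ = Real.sqrt (q * volume.real B) := by
        rw [← Real.sqrt_sq hq0.le, ← Real.sqrt_mul (by positivity), Real.sqrt_sq hq0.le]
        congr 1
        field_simp
    _ ≤ Real.sqrt (∫ t in B, ∏ i, |t i| ^ (2 * k i)) := Real.sqrt_le_sqrt hk.2.1

/-- sharp multiplicative Hardy–Littlewood–Pólya-type inequality on `ℝ^d`,
in Fourier-transform form.  If `λ_j > 0` sum to `1` and `k = ∑_j λ_j r^j`, then for every
measurable `y : ℝ^d → ℂ` with `∫ ∏_i |t_i|^{2r^j_i} |y(t)|² dt < ∞` for each `j`, the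
weighted integrand with exponent `k` is integrable and
`(∫ ∏_i |t_i|^{2k_i}|y|²)^{1/2} ≤ ∏_j (∫ ∏_i |t_i|^{2r^j_i}|y|²)^{λ_j/2}`; moreover the
constant `1` is sharp: the supremum of the ratio of the two sides over admissible `y` with
nonvanishing right-hand side equals `1`. -/
theorem statement15
    (d : ℕ) (hd : 0 < d) (m : ℕ)
    (k : Fin d → ℝ) (r : Fin (m + 1) → Fin d → ℝ)
    (lam : Fin (m + 1) → ℝ) (hlam : ∀ j, 0 < lam j) (hlam1 : ∑ j, lam j = 1)
    (hcomb : ∀ i, k i = ∑ j, lam j * r j i) :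
    (∀ y : (Fin d → ℝ) → ℂ, Measurable y →
      (∀ j, Integrable (fun t : Fin d → ℝ => (∏ i, |t i| ^ (2 * r j i)) * ‖y t‖ ^ 2)) →
      Integrable (fun t : Fin d → ℝ => (∏ i, |t i| ^ (2 * k i)) * ‖y t‖ ^ 2) ∧
      Real.sqrt (∫ t : Fin d → ℝ, (∏ i, |t i| ^ (2 * k i)) * ‖y t‖ ^ 2) ≤
        ∏ j, (∫ t : Fin d → ℝ, (∏ i, |t i| ^ (2 * r j i)) * ‖y t‖ ^ 2) ^ (lam j / 2)) ∧
    sSup {ρ : ℝ | ∃ y : (Fin d → ℝ) → ℂ, Measurable y ∧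
        (∀ j, Integrable (fun t : Fin d → ℝ => (∏ i, |t i| ^ (2 * r j i)) * ‖y t‖ ^ 2)) ∧
        (∏ j, (∫ t : Fin d → ℝ, (∏ i, |t i| ^ (2 * r j i)) * ‖y t‖ ^ 2) ^ (lam j / 2)) ≠ 0 ∧
        ρ = Real.sqrt (∫ t : Fin d → ℝ, (∏ i, |t i| ^ (2 * k i)) * ‖y t‖ ^ 2) /
          ∏ j, (∫ t : Fin d → ℝ, (∏ i, |t i| ^ (2 * r j i)) * ‖y t‖ ^ 2) ^ (lam j / 2)}
      = 1 := by
  have hmain := fun y => integrable_weight_and_sqrt_integral_le hlam hlam1 hcomb y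
  refine ⟨fun y _ hy => hmain y hy, ?_⟩
  refine csSup_eq_of_forall_le_of_forall_lt_exists_gt ?_ ?_ ?_
  · obtain ⟨y, hym, hyi, hy0, -⟩ :=
      exists_le_ratio k r hlam hlam1 one_half_pos one_half_lt_one
    exact ⟨_, y, hym, hyi, hy0, rfl⟩
  · rintro _ ⟨y, -, hyi, -, rfl⟩
    have hle := (hmain y hyi).2
    exact div_le_one_of_le₀ hle ((Real.sqrt_nonneg _).trans hle)
  · intro w hw
    obtain ⟨q, hwq, hq1⟩ := exists_between (max_lt hw zero_lt_one)
    obtain ⟨y, hym, hyi, hy0, hq⟩ := exists_le_ratio k r hlam hlam1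
      ((le_max_right w 0).trans_lt hwq) hq1
    exact ⟨_, ⟨y, hym, hyi, hy0, rfl⟩, ((le_max_left w 0).trans_lt hwq).trans_le hq⟩
end

section
/- Let 1 ≤ p < ∞ and q = p/(p−1) (q = ∞ if p = 1), and let k ∈ ℕ. Then for every infinitely differentiable 2π-periodic function x : ℝ → ℂ, ( ∫_0^{2π} |x^{(k)}(t)|² dt ) ≤ ( ∫_0^{2π} |x(t)|^p dt )^{1/p} · ( ∫_0^{2π} |x^{(2k)}(t)|^q dt )^{1/q} (with the L^∞ essential-supremum norm in place of the q-integral when q = ∞). -/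
open MeasureTheory Real
open scoped ENNReal

theorem Function.Periodic.iteratedDeriv {E : Type*} [NormedAddCommGroup E] [NormedSpace ℝ E]
    {f : ℝ → E} {T : ℝ} (hf : Function.Periodic f T) (n : ℕ) :
    Function.Periodic (iteratedDeriv n f) T := by
  intro t
  have hshift := congrFun (iteratedDeriv_comp_add_const n f T) t
  rw [funext hf] at hshift
  exact hshift.symm

theorem ContDiff.hasDerivAt_iteratedDeriv {f : ℝ → ℂ} (hf : ContDiff ℝ (⊤ : ℕ∞) f) (n : ℕ)
    (t : ℝ) : HasDerivAt (iteratedDeriv n f) (iteratedDeriv (n + 1) f t) t := by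
  rw [iteratedDeriv_succ]
  exact ((hf.differentiable_iteratedDeriv n (mod_cast ENat.natCast_lt_top n)) t).hasDerivAt

theorem ContDiff.continuous_iteratedDeriv_of_infty {f : ℝ → ℂ} (hf : ContDiff ℝ (⊤ : ℕ∞) f)
    (n : ℕ) : Continuous (iteratedDeriv n f) :=
  continuous_iff_continuousAt.2 fun t => (hf.hasDerivAt_iteratedDeriv n t).continuousAt

/-- Integration by parts over a period: the boundary terms cancel. -/
theorem integral_iteratedDeriv_succ_mul_star {f : ℝ → ℂ} {T : ℝ} (hf : ContDiff ℝ (⊤ : ℕ∞) f)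
    (hper : Function.Periodic f T) (m n : ℕ) :
    ∫ t in (0 : ℝ)..T, iteratedDeriv (m + 1) f t * star (iteratedDeriv n f t) =
      -∫ t in (0 : ℝ)..T, iteratedDeriv m f t * star (iteratedDeriv (n + 1) f t) := by
  have hc := hf.continuous_iteratedDeriv_of_infty
  have hparts := intervalIntegral.integral_mul_deriv_eq_deriv_mul_of_hasDerivAt
    (hc m).continuousOn (hc n).star.continuousOn
    (fun t _ => hf.hasDerivAt_iteratedDeriv m t)
    (fun t _ => (hf.hasDerivAt_iteratedDeriv n t).star)
    ((hc (m + 1)).intervalIntegrable 0 T) ((hc (n + 1)).star.intervalIntegrable 0 T)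
  rw [hparts, (hper.iteratedDeriv m).eq, (hper.iteratedDeriv n).eq]
  ring

theorem enorm_integral_iteratedDeriv_add_mul_star {f : ℝ → ℂ} {T : ℝ}
    (hf : ContDiff ℝ (⊤ : ℕ∞) f) (hper : Function.Periodic f T) (m n j : ℕ) :
    ‖∫ t in (0 : ℝ)..T, iteratedDeriv (m + j) f t * star (iteratedDeriv n f t)‖ₑ =
      ‖∫ t in (0 : ℝ)..T, iteratedDeriv m f t * star (iteratedDeriv (n + j) f t)‖ₑ := by
  induction j generalizing n with
  | zero => rfl
  | succ j ih =>
    rw [← add_assoc, integral_iteratedDeriv_succ_mul_star hf hper, enorm_neg, ih (n + 1),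
      add_right_comm, add_assoc]

theorem eLpNorm_two_sq_eq_enorm_integral_mul_star {α : Type*} [MeasurableSpace α] {μ : Measure α}
    {f : α → ℂ} (hf : MemLp f 2 μ) :
    eLpNorm f 2 μ ^ 2 = ‖∫ a, f a * star (f a) ∂μ‖ₑ := by
  have hint : Integrable (fun a => ‖f a‖ ^ 2) μ := hf.norm.integrable_sq
  have hreal : ∫ a, f a * star (f a) ∂μ = ((∫ a, ‖f a‖ ^ 2 ∂μ : ℝ) : ℂ) := by
    rw [← integral_complex_ofReal]
    congr with a
    simpa using Complex.mul_conj' (f a)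
  have hpow := eLpNorm_nnreal_pow_eq_lintegral (f := f) (μ := μ) (p := 2) two_ne_zero
  simp only [NNReal.coe_ofNat, ENNReal.coe_ofNat, ENNReal.rpow_ofNat] at hpow
  rw [hpow, hreal, ← ofReal_norm, Complex.norm_real, Real.norm_of_nonneg (by positivity),
    ofReal_integral_eq_lintegral_ofReal hint (ae_of_all _ fun a => by positivity)]
  congr with a
  rw [ENNReal.ofReal_pow (norm_nonneg _), ofReal_norm]

/-- Solyar-type inequality on the circle.  For `1 ≤ p < ∞` with conjugate
exponent `q` (`1/p + 1/q = 1`, `q = ∞` when `p = 1`) and `k ∈ ℕ`, every infinitely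
differentiable `2π`-periodic function `x : ℝ → ℂ` satisfies
`∫_0^{2π} |x^{(k)}|² ≤ (∫_0^{2π} |x|^p)^{1/p} (∫_0^{2π} |x^{(2k)}|^q)^{1/q}`
(with the essential supremum norm when `q = ∞`); this is expressed below via `L^p`-norms with
respect to Lebesgue measure restricted to `(0, 2π]`:
`‖x^{(k)}‖_{L²}² ≤ ‖x‖_{L^p} ‖x^{(2k)}‖_{L^q}`. -/
theorem statement18
    (p q : ℝ≥0∞) (hp1 : 1 ≤ p) (hp2 : p ≠ ⊤) (hpq : 1 / p + 1 / q = 1)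
    (k : ℕ) (hk : 0 < k)
    (x : ℝ → ℂ) (hx : ContDiff ℝ (⊤ : ℕ∞) x) (hper : Function.Periodic x (2 * π)) :
    eLpNorm (iteratedDeriv k x) 2 (volume.restrict (Set.Ioc 0 (2 * π))) ^ 2 ≤
      eLpNorm x p (volume.restrict (Set.Ioc 0 (2 * π))) *
      eLpNorm (iteratedDeriv (2 * k) x) q (volume.restrict (Set.Ioc 0 (2 * π))) := by
  have hc := hx.continuous_iteratedDeriv_of_infty
  have hT : (0 : ℝ) ≤ 2 * π := by positivity
  have : ENNReal.HolderConjugate p q := ENNReal.holderConjugate_iff.2 (by simpa using hpq)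
  set μ : Measure ℝ := volume.restrict (Set.Ioc 0 (2 * π))
  have hmem : MemLp (iteratedDeriv k x) 2 μ :=
    (memLp_two_iff_integrable_sq_norm (hc k).aestronglyMeasurable).2
      ((intervalIntegrable_iff_integrableOn_Ioc_of_le hT).1
        (((hc k).norm.pow 2).intervalIntegrable 0 (2 * π)))
  have hmove := enorm_integral_iteratedDeriv_add_mul_star hx hper 0 k k
  simp only [intervalIntegral.integral_of_le hT, zero_add, iteratedDeriv_zero, ← two_mul] at hmove
  calc
    eLpNorm (iteratedDeriv k x) 2 μ ^ 2
        = ‖∫ t, x t * star (iteratedDeriv (2 * k) x t) ∂μ‖ₑ := by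
      rw [eLpNorm_two_sq_eq_enorm_integral_mul_star hmem, hmove]
    _ ≤ eLpNorm (fun t => x t * star (iteratedDeriv (2 * k) x t)) 1 μ := by
      rw [eLpNorm_one_eq_lintegral_enorm]
      exact enorm_integral_le_lintegral_enorm _
    _ ≤ (1 : NNReal) * eLpNorm x p μ * eLpNorm (iteratedDeriv (2 * k) x) q μ :=
      eLpNorm_le_eLpNorm_mul_eLpNorm_of_nnnorm hx.continuous.aestronglyMeasurable
        (hc (2 * k)).aestronglyMeasurable (fun z w => z * star w) 1
        (ae_of_all _ fun t => by simp)
    _ = eLpNorm x p μ * eLpNorm (iteratedDeriv (2 * k) x) q μ := by simp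
end

section
/- For every ε ∈ (0,1), the function f(τ) := ∑_{n=1}^∞ τ / ( (τn)^{1−ε} + (τn)^{1+ε} ), τ > 0, is bounded on (0, ∞), i.e., sup_{τ>0} ∑_{n=1}^∞ τ / ( (τn)^{1−ε} + (τn)^{1+ε} ) < ∞. More precisely, f(τ) ≤ ∑_{n=1}^∞ n^{−1−ε} for τ ≥ 1, and f(τ) ≤ ∫_0^{1/τ} τ^ε t^{ε−1} dt + ∑_{j=1}^∞ τ j^{−1−ε} (1/τ + 1) for 0 < τ < 1. -/
theorem summable_pnat_rpow_neg_one_sub {ε : ℝ} (hε : 0 < ε) :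
    Summable fun n : ℕ+ => (n : ℝ) ^ (-1 - ε) :=
  (Real.summable_nat_rpow.2 (by linarith : -1 - ε < -1)).comp_injective PNat.coe_injective

theorem div_rpow_add_rpow_le_left {ε τ x : ℝ} (hτ : 0 < τ) (hx : 0 < x) :
    τ / ((τ * x) ^ (1 - ε) + (τ * x) ^ (1 + ε)) ≤ τ ^ ε * x ^ (ε - 1) := by
  have h : 0 < τ * x := mul_pos hτ hx
  calc τ / ((τ * x) ^ (1 - ε) + (τ * x) ^ (1 + ε)) ≤ τ / (τ * x) ^ (1 - ε) := by
        gcongr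
        exact le_add_of_nonneg_right (by positivity)
    _ = τ ^ ε * x ^ (ε - 1) := by
        rw [div_eq_mul_inv, ← Real.rpow_neg h.le, neg_sub, Real.mul_rpow hτ.le hx.le, ← mul_assoc,
          Real.rpow_sub_one hτ.ne', mul_div_cancel₀ _ hτ.ne']

theorem div_rpow_add_rpow_le_right {ε τ x : ℝ} (hτ : 0 < τ) (hx : 0 < x) :
    τ / ((τ * x) ^ (1 - ε) + (τ * x) ^ (1 + ε)) ≤ τ * (τ * x) ^ (-1 - ε) := by
  have h : 0 < τ * x := mul_pos hτ hx
  calc τ / ((τ * x) ^ (1 - ε) + (τ * x) ^ (1 + ε)) ≤ τ / (τ * x) ^ (1 + ε) := by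
        gcongr
        exact le_add_of_nonneg_left (by positivity)
    _ = τ * (τ * x) ^ (-1 - ε) := by
        rw [div_eq_mul_inv, ← Real.rpow_neg h.le, neg_add']

theorem summable_div_rpow_add_rpow {ε τ : ℝ} (hε : 0 < ε) (hτ : 0 < τ) :
    Summable fun n : ℕ+ => τ / ((τ * n) ^ (1 - ε) + (τ * n) ^ (1 + ε)) := by
  refine Summable.of_nonneg_of_le (fun n => by positivity)
    (fun n => div_rpow_add_rpow_le_right hτ (by exact_mod_cast n.pos)) ?_
  simp_rw [Real.mul_rpow hτ.le (Nat.cast_nonneg _)]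
  exact ((summable_pnat_rpow_neg_one_sub hε).mul_left _).mul_left _

theorem tsum_div_rpow_add_rpow_le_of_one_le {ε τ : ℝ} (hε : 0 < ε) (hτ : 1 ≤ τ) :
    (∑' n : ℕ+, τ / ((τ * n) ^ (1 - ε) + (τ * n) ^ (1 + ε))) ≤
      ∑' n : ℕ+, (n : ℝ) ^ (-1 - ε) := by
  have hτ0 : 0 < τ := by linarith
  refine (summable_div_rpow_add_rpow hε hτ0).tsum_le_tsum (fun n => ?_)
    (summable_pnat_rpow_neg_one_sub hε)
  have hn : (0 : ℝ) < n := by exact_mod_cast n.pos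
  refine (div_rpow_add_rpow_le_right hτ0 hn).trans ?_
  rw [Real.mul_rpow hτ0.le hn.le, ← mul_assoc]
  refine mul_le_of_le_one_left (by positivity) ?_
  rw [← Real.rpow_one_add' hτ0.le (by linarith)]
  exact Real.rpow_le_one_of_one_le_of_nonpos hτ (by linarith)

theorem sum_Icc_rpow_sub_one_le {ε : ℝ} (hε : 0 < ε) (hε1 : ε ≤ 1) (N : ℕ) :
    ∑ n ∈ Finset.Icc 1 N, (n : ℝ) ^ (ε - 1) ≤ (N : ℝ) ^ ε / ε := by
  induction N with
  | zero => simp [Real.zero_rpow hε.ne']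
  | succ N ih =>
    rw [Finset.sum_Icc_succ_top (by omega)]
    have hx : (0 : ℝ) < (N + 1 : ℕ) := by positivity
    have hN : (N : ℝ) = (N + 1 : ℕ) - 1 := by push_cast; ring
    have hx1 : (1 : ℝ) ≤ (N + 1 : ℕ) := by simp
    generalize ((N + 1 : ℕ) : ℝ) = x at hx hN hx1 ⊢
    have bernoulli : (1 + -(1 / x)) ^ ε ≤ 1 + ε * -(1 / x) :=
      rpow_one_add_le_one_add_mul_self (by
        rw [neg_le_neg_iff]; exact (div_le_one hx).2 hx1) hε.le hε1
    have hpow : (N : ℝ) ^ ε ≤ x ^ ε - ε * x ^ (ε - 1) := by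
      have hfac : (N : ℝ) = x * (1 + -(1 / x)) := by rw [hN]; field_simp; ring
      have hnn : 0 ≤ 1 + -(1 / x) := by
        have := (div_le_one hx).2 hx1
        linarith
      rw [hfac, Real.mul_rpow hx.le hnn, Real.rpow_sub_one hx.ne']
      calc x ^ ε * (1 + -(1 / x)) ^ ε ≤ x ^ ε * (1 + ε * -(1 / x)) := by gcongr
        _ = x ^ ε - ε * (x ^ ε / x) := by ring
    rw [le_div_iff₀ hε] at ih ⊢
    linarith

theorem integral_rpow_mul_rpow_sub_one {ε τ : ℝ} (hε : 0 < ε) (hτ : 0 < τ) :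
    (∫ t in (0 : ℝ)..(1 / τ), τ ^ ε * t ^ (ε - 1)) = 1 / ε := by
  rw [intervalIntegral.integral_const_mul, integral_rpow (Or.inl (by linarith)), sub_add_cancel,
    Real.zero_rpow hε.ne', sub_zero, ← mul_div_assoc, ← Real.mul_rpow hτ.le (by positivity),
    mul_one_div_cancel hτ.ne', Real.one_rpow]

theorem sum_div_rpow_add_rpow_le_of_mul_lt_one {ε τ : ℝ} (hε : 0 < ε) (hε1 : ε ≤ 1) (hτ : 0 < τ)
    (s : Finset ℕ+) (hs : ∀ n ∈ s, τ * n < 1) :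
    ∑ n ∈ s, τ / ((τ * n) ^ (1 - ε) + (τ * n) ^ (1 + ε)) ≤ 1 / ε := by
  have hsub : s.image (fun n : ℕ+ => (n : ℕ)) ⊆ Finset.Icc 1 ⌊1 / τ⌋₊ := by
    intro k hk
    obtain ⟨n, hn, rfl⟩ := Finset.mem_image.1 hk
    refine Finset.mem_Icc.2 ⟨n.pos, Nat.le_floor ?_⟩
    rw [le_div_iff₀ hτ, mul_comm]
    exact (hs n hn).le
  calc ∑ n ∈ s, τ / ((τ * n) ^ (1 - ε) + (τ * n) ^ (1 + ε))
      ≤ ∑ n ∈ s, τ ^ ε * (n : ℝ) ^ (ε - 1) :=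
        Finset.sum_le_sum fun n _ => div_rpow_add_rpow_le_left hτ (by exact_mod_cast n.pos)
    _ = τ ^ ε * ∑ k ∈ s.image (fun n : ℕ+ => (n : ℕ)), (k : ℝ) ^ (ε - 1) := by
        rw [Finset.sum_image PNat.coe_injective.injOn, Finset.mul_sum]
    _ ≤ τ ^ ε * ∑ k ∈ Finset.Icc 1 ⌊1 / τ⌋₊, (k : ℝ) ^ (ε - 1) := by
        gcongr
    _ ≤ τ ^ ε * ((1 / τ) ^ ε / ε) := by
        gcongr
        refine (sum_Icc_rpow_sub_one_le hε hε1 _).trans ?_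
        gcongr
        exact Nat.floor_le (by positivity)
    _ = 1 / ε := by
        rw [← mul_div_assoc, ← Real.mul_rpow hτ.le (by positivity), mul_one_div_cancel hτ.ne',
          Real.one_rpow]

theorem card_le_of_floor_mul_eq {τ : ℝ} (hτ : 0 < τ) (j : ℕ) (s : Finset ℕ+)
    (hs : ∀ n ∈ s, ⌊τ * n⌋₊ = j) : (s.card : ℝ) ≤ 1 / τ + 1 := by
  have hsub : s.image (fun n : ℕ+ => (n : ℕ)) ⊆ Finset.Ico ⌈j / τ⌉₊ ⌈(j + 1) / τ⌉₊ := by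
    intro k hk
    obtain ⟨n, hn, rfl⟩ := Finset.mem_image.1 hk
    obtain ⟨h₁, h₂⟩ := (Nat.floor_eq_iff (by positivity)).1 (hs n hn)
    rw [Finset.mem_Ico, Nat.ceil_le, Nat.lt_ceil, div_le_iff₀ hτ, lt_div_iff₀ hτ, mul_comm _ τ]
    exact ⟨h₁, h₂⟩
  have hcard := Finset.card_le_card hsub
  rw [Finset.card_image_of_injective _ PNat.coe_injective, Nat.card_Ico] at hcard
  have hmono : ⌈j / τ⌉₊ ≤ ⌈(j + 1) / τ⌉₊ := by gcongr; linarith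
  have h₁ := Nat.le_ceil (j / τ)
  have h₂ := Nat.ceil_lt_add_one (a := (j + 1) / τ) (by positivity)
  have h₃ : (s.card : ℝ) ≤ ⌈(j + 1) / τ⌉₊ - ⌈j / τ⌉₊ := by
    rw [← Nat.cast_sub hmono]
    exact_mod_cast hcard
  rw [add_div] at h₂ h₃
  linarith

theorem sum_div_rpow_add_rpow_le_of_one_le_mul {ε τ : ℝ} (hε : 0 < ε) (hτ : 0 < τ)
    (s : Finset ℕ+) (hs : ∀ n ∈ s, 1 ≤ τ * n) :
    ∑ n ∈ s, τ / ((τ * n) ^ (1 - ε) + (τ * n) ^ (1 + ε)) ≤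
      ∑' j : ℕ+, τ * (j : ℝ) ^ (-1 - ε) * (1 / τ + 1) := by
  let φ : ℕ+ → ℕ+ := fun n => ⌊τ * n⌋₊.toPNat'
  have hφ : ∀ n ∈ s, ((φ n : ℕ+) : ℕ) = ⌊τ * n⌋₊ := fun n hn =>
    PNat.toPNat'_coe (Nat.floor_pos.2 (hs n hn))
  rw [← Finset.sum_fiberwise_of_maps_to (fun n hn => Finset.mem_image_of_mem φ hn)]
  refine (Finset.sum_le_sum fun j _ => ?_).trans
    ((((summable_pnat_rpow_neg_one_sub hε).mul_left τ).mul_right (1 / τ + 1)).sum_le_tsum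
      (s.image φ) fun j _ => by positivity)
  have hfloor : ∀ n ∈ s.filter (φ · = j), ⌊τ * n⌋₊ = (j : ℕ) := by
    intro n hn
    obtain ⟨hns, rfl⟩ := Finset.mem_filter.1 hn
    exact (hφ n hns).symm
  refine (Finset.sum_le_card_nsmul _ _ (τ * (j : ℝ) ^ (-1 - ε)) fun n hn => ?_).trans ?_
  · have hj : (0 : ℝ) < j := by exact_mod_cast j.pos
    refine (div_rpow_add_rpow_le_right hτ (by exact_mod_cast n.pos)).trans ?_
    refine mul_le_mul_of_nonneg_left (Real.rpow_le_rpow_of_nonpos hj ?_ (by linarith)) hτ.le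
    rw [← hfloor n hn]
    exact Nat.floor_le (by positivity)
  · rw [nsmul_eq_mul, mul_comm]
    gcongr
    exact card_le_of_floor_mul_eq hτ j _ hfloor

theorem tsum_div_rpow_add_rpow_le {ε τ : ℝ} (hε : 0 < ε) (hε1 : ε ≤ 1) (hτ : 0 < τ) :
    (∑' n : ℕ+, τ / ((τ * n) ^ (1 - ε) + (τ * n) ^ (1 + ε))) ≤
      1 / ε + ∑' j : ℕ+, τ * (j : ℝ) ^ (-1 - ε) * (1 / τ + 1) := by
  refine (summable_div_rpow_add_rpow hε hτ).tsum_le_of_sum_le fun s => ?_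
  rw [← Finset.sum_filter_add_sum_filter_not s (fun n : ℕ+ => τ * n < 1)]
  exact add_le_add
    (sum_div_rpow_add_rpow_le_of_mul_lt_one hε hε1 hτ _ fun n hn => (Finset.mem_filter.1 hn).2)
    (sum_div_rpow_add_rpow_le_of_one_le_mul hε hτ _ fun n hn =>
      not_lt.1 (Finset.mem_filter.1 hn).2)

/-- boundedness of the auxiliary function `f`.  For every `ε ∈ (0,1)`, the
positive series `f(τ) = ∑_{n≥1} τ/((τn)^{1-ε} + (τn)^{1+ε})` converges for each `τ > 0` and
is bounded on `(0,∞)`; more precisely `f(τ) ≤ ∑_{n≥1} n^{-1-ε}` for `τ ≥ 1` and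
`f(τ) ≤ ∫_0^{1/τ} τ^ε t^{ε-1} dt + ∑_{j≥1} τ j^{-1-ε} (1/τ + 1)` for `0 < τ < 1`. -/
theorem statement19 (ε : ℝ) (hε : ε ∈ Set.Ioo (0 : ℝ) 1) :
    (∀ τ : ℝ, 0 < τ →
      Summable fun n : ℕ+ => τ / ((τ * n) ^ (1 - ε) + (τ * n) ^ (1 + ε))) ∧
    (∃ C : ℝ, ∀ τ : ℝ, 0 < τ →
      (∑' n : ℕ+, τ / ((τ * n) ^ (1 - ε) + (τ * n) ^ (1 + ε))) ≤ C) ∧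
    (∀ τ : ℝ, 1 ≤ τ →
      (∑' n : ℕ+, τ / ((τ * n) ^ (1 - ε) + (τ * n) ^ (1 + ε))) ≤
        ∑' n : ℕ+, (n : ℝ) ^ (-1 - ε)) ∧
    (∀ τ : ℝ, 0 < τ → τ < 1 →
      (∑' n : ℕ+, τ / ((τ * n) ^ (1 - ε) + (τ * n) ^ (1 + ε))) ≤
        (∫ t in (0 : ℝ)..(1 / τ), τ ^ ε * t ^ (ε - 1)) +
        ∑' j : ℕ+, τ * (j : ℝ) ^ (-1 - ε) * (1 / τ + 1)) := by
  obtain ⟨hε0, hε1⟩ := hε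
  refine ⟨fun τ hτ => summable_div_rpow_add_rpow hε0 hτ, ?_,
    fun τ hτ => tsum_div_rpow_add_rpow_le_of_one_le hε0 hτ, fun τ hτ _ => ?_⟩
  · have hζ : 0 ≤ ∑' n : ℕ+, (n : ℝ) ^ (-1 - ε) := tsum_nonneg fun n => by positivity
    refine ⟨1 / ε + 2 * ∑' n : ℕ+, (n : ℝ) ^ (-1 - ε), fun τ hτ => ?_⟩
    rcases le_total 1 τ with h | h
    · have : 0 < 1 / ε := by positivity
      linarith [tsum_div_rpow_add_rpow_le_of_one_le hε0 h]
    · refine (tsum_div_rpow_add_rpow_le hε0 hε1.le hτ).trans ?_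
      rw [tsum_mul_right, tsum_mul_left, mul_right_comm, mul_add, mul_one_div_cancel hτ.ne']
      gcongr
      linarith
  · rw [integral_rpow_mul_rpow_sub_one hε0 hτ]
    exact tsum_div_rpow_add_rpow_le hε0 hε1.le hτ
end
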